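/- arXiv:math/0403215 — 7 statements merged into one kernel-verified Lean document; each statement's English description precedes it below -/
import Mathlib

section
/- Let A be an integral domain that is a commutative ℂ-algebra and let ∂ be a locally nilpotent ℂ-derivation of A. Then the kernel of ∂ is integrally closed in A; that is, every element of A that is integral over ker ∂ already belongs to ker ∂. -/
/-- A `ℂ`-derivation `D` of a commutative `ℂ`-algebra `A` is locally nilpotent if for every
`f ∈ A` there is `n` with `D^[n] f = 0`. -/
def Derivation.IsLocallyNilpotent {A : Type*} [CommRing A] [Algebra ℂ A]
    (D : Derivation ℂ A A) : Prop :=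
  ∀ f : A, ∃ n : ℕ, (⇑D)^[n] f = 0

/-- The kernel of a derivation, as a `ℂ`-subalgebra. -/
def Derivation.kerSubalgebra {A : Type*} [CommRing A] [Algebra ℂ A]
    (D : Derivation ℂ A A) : Subalgebra ℂ A where
  carrier := {a | D a = 0}
  mul_mem' := by
    intro a b ha hb
    simp only [Set.mem_setOf_eq] at *
    rw [Derivation.leibniz, ha, hb, smul_zero, smul_zero, add_zero]
  add_mem' := by
    intro a b ha hb
    simp only [Set.mem_setOf_eq] at *
    rw [map_add, ha, hb, add_zero]
  algebraMap_mem' := fun r => D.map_algebraMap r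

open Polynomial in
/-- In characteristic zero, an `R`-derivation of a domain kills every element algebraic over `R`. -/
theorem Derivation.eq_zero_of_isAlgebraic {R A : Type*} [CommRing R] [CommRing A] [IsDomain A]
    [CharZero A] [Algebra R A] [FaithfulSMul R A] (D : Derivation R A A) {a : A}
    (ha : IsAlgebraic R a) : D a = 0 := by
  have hinj := FaithfulSMul.algebraMap_injective R A
  have : IsDomain R := hinj.isDomain (algebraMap R A)
  have : CharZero R := (algebraMap R A).charZero
  obtain ⟨p, hp, hpa⟩ := ha
  induction hn : p.natDegree using Nat.strong_induction_on generalizing p with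
  | _ n ih =>
    have hdeg : p.natDegree ≠ 0 := fun h => by
      rw [natDegree_eq_zero] at h
      obtain ⟨c, rfl⟩ := h
      rw [aeval_C, FaithfulSMul.algebraMap_eq_zero_iff] at hpa
      exact hp (by rw [hpa, C_0])
    have hD := D.map_aeval p a
    rw [hpa, map_zero, smul_eq_mul, eq_comm, mul_eq_zero] at hD
    refine hD.elim (fun h => ?_) id
    exact ih _ (hn ▸ natDegree_derivative_lt hdeg) (derivative p)
      (fun h => hdeg (derivative_eq_zero.mp h)) h rfl

/-- A derivation is linear over its kernel. -/
def Derivation.overKer {A : Type*} [CommRing A] [Algebra ℂ A] (D : Derivation ℂ A A) :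
    Derivation D.kerSubalgebra A A :=
  Derivation.mk'
    { toFun := D
      map_add' := map_add D
      map_smul' := fun c x => by
        have hc : D (c : A) = 0 := c.2
        simp [Subalgebra.smul_def, hc] }
    D.leibniz

/-- For an integral domain `A` which is a commutative `ℂ`-algebra and a locally
nilpotent `ℂ`-derivation `D` of `A`, the kernel of `D` is integrally closed in `A`: every element
of `A` integral over `ker D` already lies in `ker D`. -/
theorem kernel_of_locally_nilpotent_derivation_integrally_closed
    {A : Type*} [CommRing A] [IsDomain A] [Algebra ℂ A]
    (D : Derivation ℂ A A) (hD : D.IsLocallyNilpotent)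
    (a : A) (ha : IsIntegral (D.kerSubalgebra) a) :
    D a = 0 := by
  have : CharZero A := charZero_of_injective_algebraMap (algebraMap ℂ A).injective
  exact D.overKer.eq_zero_of_isAlgebraic ha.isAlgebraic
end

section
/- Let A be an integral domain that is a commutative ℂ-algebra, let ∂ be a nonzero locally nilpotent ℂ-derivation of A, and let v ∈ A. Then the principal ideal vA is stable under ∂ (i.e., ∂(vA) ⊆ vA) if and only if ∂(v) = 0. -/
namespace Derivation

variable {A : Type*} [CommRing A] [Algebra ℂ A] (D : Derivation ℂ A A)

theorem iterate_apply_zero (n : ℕ) : (⇑D)^[n] 0 = 0 :=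
  Function.iterate_fixed (map_zero D) n

theorem iterate_apply_eq_zero_of_le {f : A} {m n : ℕ} (hf : (⇑D)^[m] f = 0) (h : m ≤ n) :
    (⇑D)^[n] f = 0 := by
  obtain ⟨k, rfl⟩ := Nat.exists_eq_add_of_le' h
  rw [Function.iterate_add_apply, hf, D.iterate_apply_zero]

theorem iterate_mul_of_apply_eq_zero {f : A} (hf : D f = 0) (g : A) (n : ℕ) :
    (⇑D)^[n] (f * g) = f * (⇑D)^[n] g := by
  induction n with
  | zero => rfl
  | succ n ih => simp [Function.iterate_succ_apply', ih, hf]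

/-- The top-order term of the iterated Leibniz rule for two elements of known nilpotency order. -/
theorem exists_iterate_add_mul_eq_nsmul {m n : ℕ} {f g : A} (hf : (⇑D)^[m + 1] f = 0)
    (hg : (⇑D)^[n + 1] g = 0) :
    ∃ c : ℕ, c ≠ 0 ∧ (⇑D)^[m + n] (f * g) = c • ((⇑D)^[m] f * (⇑D)^[n] g) := by
  induction m generalizing n f g with
  | zero => exact ⟨1, one_ne_zero, by simpa using D.iterate_mul_of_apply_eq_zero hf g n⟩
  | succ m ihm =>
    induction n generalizing g with
    | zero =>
      refine ⟨1, one_ne_zero, ?_⟩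
      simpa [mul_comm] using D.iterate_mul_of_apply_eq_zero hg f (m + 1)
    | succ n ihn =>
      obtain ⟨c, hc, h₁⟩ := ihm (f := D f) (g := g) hf hg
      obtain ⟨d, -, h₂⟩ := ihn (g := D g) hg
      refine ⟨d + c, by lia, ?_⟩
      have e : m + 1 + n = m + (n + 1) := by lia
      rw [e] at h₂
      rw [show m + 1 + (n + 1) = m + (n + 1) + 1 by lia, Function.iterate_succ_apply, D.leibniz,
        smul_eq_mul, smul_eq_mul, iterate_map_add, h₂, mul_comm g, h₁, add_smul]
      rfl

variable {D}

theorem IsLocallyNilpotent.exists_iterate_ne_zero (hD : D.IsLocallyNilpotent) {f : A}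
    (hf : f ≠ 0) : ∃ n : ℕ, (⇑D)^[n] f ≠ 0 ∧ (⇑D)^[n + 1] f = 0 := by
  obtain ⟨n, hn, h⟩ := Nat.exists_not_and_succ_of_not_zero_of_exists
    (p := fun n => (⇑D)^[n] f = 0) hf (hD f)
  exact ⟨n, hn, h⟩

theorem IsLocallyNilpotent.apply_eq_zero_of_dvd [IsDomain A] (hD : D.IsLocallyNilpotent) {v : A}
    (hv : v ∣ D v) : D v = 0 := by
  by_contra h0
  obtain ⟨a, ha⟩ := hv
  have hva : v ≠ 0 ∧ a ≠ 0 := by rwa [ha, ← Ne, mul_ne_zero_iff] at h0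
  obtain ⟨n, hn, hn'⟩ := hD.exists_iterate_ne_zero hva.1
  obtain ⟨m, hm, hm'⟩ := hD.exists_iterate_ne_zero hva.2
  obtain ⟨c, hc, h⟩ := D.exists_iterate_add_mul_eq_nsmul hn' hm'
  have : CharZero A := charZero_of_injective_algebraMap (algebraMap ℂ A).injective
  rw [← ha, ← Function.iterate_succ_apply,
    D.iterate_apply_eq_zero_of_le hn' (by lia), eq_comm, smul_eq_zero] at h
  exact h.elim hc (mul_ne_zero hn hm)

end Derivation

/-- Let `A` be an integral domain that is a commutative `ℂ`-algebra, `D` a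
nonzero locally nilpotent `ℂ`-derivation of `A`, and `v ∈ A`.  The principal ideal `vA` is
stable under `D` if and only if `D v = 0`. -/
theorem principal_ideal_stable_iff_mem_kernel
    {A : Type*} [CommRing A] [IsDomain A] [Algebra ℂ A]
    (D : Derivation ℂ A A) (hD : D.IsLocallyNilpotent) (hne : D ≠ 0) (v : A) :
    (∀ x ∈ Ideal.span {v}, D x ∈ Ideal.span {v}) ↔ D v = 0 := by
  simp only [Ideal.mem_span_singleton]
  refine ⟨fun h => hD.apply_eq_zero_of_dvd (h v dvd_rfl), ?_⟩
  rintro h _ ⟨a, rfl⟩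
  simp [h]
end

section
/- Let A be a finitely generated integral domain over ℂ and let f₀ ∈ A be nonzero. Suppose the localization A[1/f₀] is isomorphic as a ℂ-algebra to a polynomial ring B[t] in one variable over some commutative ℂ-algebra B. Then A admits a nonzero locally nilpotent ℂ-derivation. (Indeed, for a suitable e ≥ 0 the derivation f₀^e·∂/∂t of B[t] ≅ A[1/f₀] restricts to a nonzero locally nilpotent derivation of A.) -/
open Polynomial in
/-- If `φ : A → B[X]` is an injective algebra map and `C c * derivative` maps the image of `φ`
into itself, then `C c * derivative` restricts to a locally nilpotent derivation of `A`. -/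
theorem exists_isLocallyNilpotent_of_C_mul_derivative_mem_range
    {A B : Type*} [CommRing A] [Algebra ℂ A] [CommRing B] [Algebra ℂ B]
    (φ : A →ₐ[ℂ] B[X]) (hφ : Function.Injective φ) (c : B)
    (h : ∀ a, C c * derivative (φ a) ∈ φ.range) :
    ∃ D : Derivation ℂ A A, D.IsLocallyNilpotent ∧ ∀ a, φ (D a) = C c * derivative (φ a) := by
  choose d hd using h
  replace hd : ∀ a, φ (d a) = C c * derivative (φ a) := hd
  let D : Derivation ℂ A A := Derivation.mk'
    { toFun := d
      map_add' := fun x y => hφ (by simp only [map_add, hd, mul_add])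
      map_smul' := fun r x => hφ (by
        simp only [map_smul, hd, derivative_smul, mul_smul_comm, RingHom.id_apply]) }
    (fun x y => hφ (by
      simp only [LinearMap.coe_mk, AddHom.coe_mk, smul_eq_mul, map_add, map_mul, hd,
        derivative_mul]
      ring))
  have hD : ∀ a, φ (D a) = C c * derivative (φ a) := hd
  have hiter : ∀ (k : ℕ) (a : A), φ (D^[k] a) = C (c ^ k) * derivative^[k] (φ a) := by
    intro k a
    induction k with
    | zero => simp
    | succ k ih =>
      rw [Function.iterate_succ_apply', hD, ih, derivative_C_mul, Function.iterate_succ_apply',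
        ← mul_assoc, ← C_mul, pow_succ']
  refine ⟨D, fun f => ⟨(φ f).natDegree + 1, hφ ?_⟩, hD⟩
  rw [hiter, iterate_derivative_eq_zero (Nat.lt_succ_self _), mul_zero, map_zero]

open Polynomial in
/-- If every polynomial is carried into the image of `φ : A → B[X]` by a power of `C b`, and `A`
is finitely generated, then `C (b ^ n) * derivative` preserves the image of `φ` for some `n`. -/
theorem exists_C_pow_mul_derivative_mem_range
    {A B : Type*} [CommRing A] [Algebra ℂ A] [Algebra.FiniteType ℂ A] [CommRing B] [Algebra ℂ B]
    (φ : A →ₐ[ℂ] B[X]) (b : B) (hb : C b ∈ φ.range)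
    (h : ∀ p : B[X], ∃ m : ℕ, C (b ^ m) * p ∈ φ.range) :
    ∃ n : ℕ, ∀ a, C (b ^ n) * derivative (φ a) ∈ φ.range := by
  obtain ⟨S, hS⟩ := Algebra.FiniteType.out (R := ℂ) (A := A)
  choose m hm using fun a => h (derivative (φ a))
  refine ⟨S.sup m, fun a => ?_⟩
  have ha : a ∈ Algebra.adjoin ℂ (S : Set A) := hS ▸ Algebra.mem_top
  induction ha using Algebra.adjoin_induction with
  | mem x hx =>
    rw [← Nat.sub_add_cancel (Finset.le_sup (f := m) hx), pow_add, C_mul, mul_assoc, C_pow]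
    exact mul_mem (pow_mem hb _) (hm x)
  | algebraMap r =>
    rw [AlgHom.commutes, Polynomial.algebraMap_apply, derivative_C, mul_zero]
    exact zero_mem _
  | add x y _ _ hx hy =>
    rw [map_add, derivative_add, mul_add]
    exact add_mem hx hy
  | mul x y _ _ hx hy =>
    rw [map_mul, derivative_mul, mul_add, ← mul_assoc, mul_left_comm]
    exact add_mem (mul_mem hx ⟨y, rfl⟩) (mul_mem ⟨x, rfl⟩ hy)

/-- Let `A` be a finitely generated integral domain over `ℂ` and `f₀ ∈ A`
nonzero.  If the localization `A[1/f₀]` is isomorphic as a `ℂ`-algebra to a polynomial ring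
`B[t]` in one variable over some commutative `ℂ`-algebra `B`, then `A` admits a nonzero locally
nilpotent `ℂ`-derivation. -/
theorem exists_locally_nilpotent_derivation_of_localization_polynomial
    {A : Type*} [CommRing A] [IsDomain A] [Algebra ℂ A] [Algebra.FiniteType ℂ A]
    (f₀ : A) (hf₀ : f₀ ≠ 0)
    (B : Type*) [CommRing B] [Algebra ℂ B]
    (e : Localization.Away f₀ ≃ₐ[ℂ] Polynomial B) :
    ∃ D : Derivation ℂ A A, D ≠ 0 ∧ D.IsLocallyNilpotent := by
  have hle : Submonoid.powers f₀ ≤ nonZeroDivisors A :=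
    powers_le_nonZeroDivisors_of_noZeroDivisors hf₀
  have : IsDomain (Localization.Away f₀) := IsLocalization.isDomain_localization hle
  have : IsDomain (Polynomial B) := e.symm.toMulEquiv.isDomain _
  have : IsDomain B := Polynomial.C_injective.isDomain Polynomial.C
  let φ : A →ₐ[ℂ] Polynomial B := e.toAlgHom.comp (Algebra.algHom ℂ A (Localization.Away f₀))
  have hφ_apply (a : A) : φ a = e (algebraMap A _ a) := rfl
  have hφ : Function.Injective φ := e.injective.comp (IsLocalization.injective _ hle)
  have hunit : IsUnit (φ f₀) := (IsLocalization.Away.algebraMap_isUnit f₀).map e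
  obtain ⟨b, hbu, hb⟩ := Polynomial.isUnit_iff.mp hunit
  have hden (p : Polynomial B) : ∃ m : ℕ, Polynomial.C (b ^ m) * p ∈ φ.range := by
    obtain ⟨m, a, ha⟩ := IsLocalization.Away.surj f₀ (e.symm p)
    refine ⟨m, a, ?_⟩
    change φ a = _
    rw [hφ_apply, ← ha, map_mul, map_pow, ← hφ_apply, ← hb, e.apply_symm_apply, Polynomial.C_pow,
      mul_comm]
  obtain ⟨n, hn⟩ := exists_C_pow_mul_derivative_mem_range φ b ⟨f₀, hb.symm⟩ hden
  obtain ⟨D, hD, hDφ⟩ := exists_isLocallyNilpotent_of_C_mul_derivative_mem_range φ hφ (b ^ n) hn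
  refine ⟨D, ?_, hD⟩
  rintro rfl
  obtain ⟨m, a, ha⟩ := hden Polynomial.X
  replace ha : φ a = _ := ha
  have h := hDφ a
  rw [ha, Polynomial.derivative_C_mul, Polynomial.derivative_X, mul_one, ← Polynomial.C_mul,
    Derivation.zero_apply, map_zero, eq_comm, Polynomial.C_eq_zero] at h
  exact mul_ne_zero (pow_ne_zero _ hbu.ne_zero) (pow_ne_zero _ hbu.ne_zero) h
end

section
/- Let A be an integrally closed (normal) integral domain of finite type over ℂ and let ∂ be a nonzero locally nilpotent ℂ-derivation of A. Let v ∈ ker ∂ be a nonzero element and n ≥ 1 an integer such that the polynomial X^n − v is irreducible in A[X]. Let A' be the integral closure of the domain A[X]/(X^n − v) in its field of fractions, and let u' ∈ A' denote the image of X. Then ∂ extends to a locally nilpotent ℂ-derivation ∂' of A' with ∂'(u') = 0, and this extension is unique. -/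
open Polynomial

set_option synthInstance.maxHeartbeats 400000
set_option maxHeartbeats 1000000

/-- The exponential `a ↦ ∑ tⁱ Dⁱ(a) / i!` of a locally nilpotent derivation `D`, as a ring
homomorphism to polynomials. -/
theorem Derivation.exists_exp_ringHom {k A : Type*} [Field k] [CharZero k] [CommRing A]
    [Algebra k A] (D : Derivation k A A) (hD : ∀ f : A, ∃ n : ℕ, (⇑D)^[n] f = 0) :
    ∃ φ : A →+* A[X], (∀ a i, (φ a).coeff i = ((i.factorial : k)⁻¹) • (⇑D)^[i] a) ∧
      ∀ a, derivative (φ a) = φ (D a) := by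
  have hlin : ∀ i, ∃ L : A →ₗ[k] A, ∀ a, L a = (⇑D)^[i] a := fun i =>
    ⟨D.toLinearMap ^ i, fun a => by rw [Module.End.pow_apply]; rfl⟩
  have hzero : ∀ i, (⇑D)^[i] 0 = 0 := fun i => by
    obtain ⟨L, hL⟩ := hlin i
    rw [← hL, map_zero]
  have hpoly : ∀ a, ∃ p : A[X], ∀ i, p.coeff i = ((i.factorial : k)⁻¹) • (⇑D)^[i] a := by
    intro a
    obtain ⟨n, hn⟩ := hD a
    refine ⟨∑ i ∈ Finset.range n, monomial i (((i.factorial : k)⁻¹) • (⇑D)^[i] a), fun i => ?_⟩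
    simp only [finsetSum_coeff, coeff_monomial, Finset.sum_ite_eq', Finset.mem_range]
    split_ifs with h
    · rfl
    · rw [← Nat.sub_add_cancel (not_lt.mp h), Function.iterate_add_apply, hn, hzero, smul_zero]
  choose F hF using hpoly
  have hsucc : ∀ (i : ℕ) (z : A), z * ((i : A) + 1) = ((i + 1 : ℕ) : k) • z := fun i z => by
    rw [Algebra.smul_def, _root_.map_natCast, mul_comm, Nat.cast_succ]
  have hder : ∀ a, derivative (F a) = F (D a) := by
    intro a
    ext i
    rw [coeff_derivative, hF, hF, Function.iterate_succ_apply, Nat.factorial_succ, smul_mul_assoc]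
    rw [hsucc, smul_smul]
    congr 1
    have h1 : ((i + 1 : ℕ) : k) ≠ 0 := Nat.cast_ne_zero.mpr i.succ_ne_zero
    have h2 : (i.factorial : k) ≠ 0 := Nat.cast_ne_zero.mpr i.factorial_ne_zero
    push_cast at h1 ⊢
    field_simp
  have hadd : ∀ a b, F (a + b) = F a + F b := by
    intro a b
    ext i
    obtain ⟨L, hL⟩ := hlin i
    simp only [coeff_add, hF, ← hL, map_add, smul_add]
  have hcancel : ∀ (i : ℕ) (x y : A), x * ((i : A) + 1) = y * ((i : A) + 1) → x = y := by
    intro i x y h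
    have h1 : ((i + 1 : ℕ) : k) ≠ 0 := Nat.cast_ne_zero.mpr i.succ_ne_zero
    rw [hsucc, hsucc] at h
    exact smul_right_injective A h1 h
  have hmul : ∀ i a b, (F (a * b)).coeff i = (F a * F b).coeff i := by
    intro i
    induction i with
    | zero => intro a b; simp [mul_coeff_zero, hF]
    | succ i ih =>
      intro a b
      apply hcancel i
      rw [← coeff_derivative, ← coeff_derivative, derivative_mul, hder, hder, hder, D.leibniz,
        hadd, coeff_add, coeff_add, smul_eq_mul, smul_eq_mul, ih, ih, mul_comm (F b), add_comm]
  have hone : F 1 = 1 := by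
    ext i
    rw [hF, coeff_one]
    cases i with
    | zero => simp
    | succ i => rw [Function.iterate_succ_apply, D.map_one_eq_zero, hzero]; simp
  have hF0 : F 0 = 0 := by
    ext i
    rw [hF, hzero]; simp
  exact ⟨{ toFun := F, map_one' := hone, map_zero' := hF0, map_add' := hadd,
           map_mul' := fun a b => by ext i; exact hmul i a b }, hF, hder⟩

/-- Every element of the integral closure of `B` in its field of fractions is a fraction of
elements of `B`. -/
theorem exists_mul_eq_algebraMap_integralClosure {B K : Type*} [CommRing B] [Field K]
    [Algebra B K] [IsFractionRing B K] (x : integralClosure B K) :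
    ∃ c b : B, algebraMap B (integralClosure B K) c ≠ 0 ∧
      algebraMap B (integralClosure B K) c * x = algebraMap B _ b := by
  have : IsDomain B := (IsFractionRing.injective B K).isDomain
  obtain ⟨b, c, hc, hbc⟩ := IsFractionRing.div_surjective (A := B) (x : K)
  have hc0 : algebraMap B K c ≠ 0 :=
    (map_ne_zero_iff _ (IsFractionRing.injective B K)).mpr (nonZeroDivisors.ne_zero hc)
  refine ⟨c, b, fun h => hc0 (congrArg Subtype.val h), ?_⟩
  ext
  change algebraMap B K c * x = algebraMap B K b
  rw [← hbc]
  field_simp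

/-- A ring homomorphism `φ : B → B[t]` that reduces to the identity modulo `t` extends to the
integral closure of `B` in its field of fractions. -/
theorem exists_ringHom_polynomial_integralClosure {B K : Type*} [CommRing B] [Field K]
    [Algebra B K] [IsFractionRing B K] (φ : B →+* B[X]) (hφ : ∀ b, (φ b).coeff 0 = b) :
    ∃ Ψ : integralClosure B K →+* K[X],
      (∀ b, Ψ (algebraMap B _ b) = (φ b).map (algebraMap B K)) ∧
      (∀ x, (Ψ x).coeff 0 = x) ∧ ∀ x i, IsIntegral B ((Ψ x).coeff i) := by
  have : IsDomain B := (IsFractionRing.injective B K).isDomain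
  have hinj : Function.Injective (algebraMap B K) := IsFractionRing.injective B K
  let g : B →+* FractionRing K[X] :=
    (algebraMap K[X] (FractionRing K[X])).comp ((mapRingHom (algebraMap B K)).comp φ)
  have hinjL : Function.Injective (algebraMap K[X] (FractionRing K[X])) :=
    IsFractionRing.injective _ _
  have hg : Function.Injective g := by
    refine hinjL.comp ((map_injective _ hinj).comp fun a b h => ?_)
    rw [← hφ a, h, hφ]
  let Φ : K →+* FractionRing K[X] := IsFractionRing.lift hg
  have hΦ : ∀ b, Φ (algebraMap B K b) = g b := IsFractionRing.lift_algebraMap hg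
  let : Algebra B[X] K[X] := Polynomial.algebra B K
  have hint : ∀ x : integralClosure B K, ∃ q : K[X],
      algebraMap K[X] (FractionRing K[X]) q = Φ x ∧ ∀ i, IsIntegral B (q.coeff i) := by
    intro x
    obtain ⟨p, hp, hpx⟩ := x.2
    have hroot : (p.map ((mapRingHom (algebraMap B K)).comp φ)).eval₂
        (algebraMap K[X] (FractionRing K[X])) (Φ x) = 0 := by
      rw [eval₂_map]
      have h := congrArg Φ hpx
      rw [hom_eval₂, map_zero] at h
      rw [← h]
      congr 1
      ext b
      exact (hΦ b).symm
    obtain ⟨q, hq⟩ := IsIntegrallyClosed.isIntegral_iff.mp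
      (show IsIntegral K[X] (Φ x) from ⟨_, hp.map _, hroot⟩)
    refine ⟨q, hq, Polynomial.isIntegral_iff_isIntegral_coeff.mp ⟨p.map φ, hp.map _, ?_⟩⟩
    apply hinjL
    rw [map_zero, ← hroot, hom_eval₂, hq, eval₂_map, eval₂_map]
    rfl
  choose Ψ hΨ hΨi using hint
  let Ψ' : integralClosure B K →+* K[X] :=
    { toFun := Ψ
      map_one' := hinjL (by rw [hΨ]; simp)
      map_zero' := hinjL (by rw [hΨ]; simp)
      map_add' := fun x y => hinjL (by rw [map_add, hΨ, hΨ, hΨ]; simp)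
      map_mul' := fun x y => hinjL (by rw [map_mul, hΨ, hΨ, hΨ]; simp) }
  have hB : ∀ b, Ψ' (algebraMap B _ b) = (φ b).map (algebraMap B K) := fun b =>
    hinjL ((hΨ _).trans (hΦ b))
  refine ⟨Ψ', hB, fun x => ?_, hΨi⟩
  obtain ⟨c, b, hc, hcb⟩ := exists_mul_eq_algebraMap_integralClosure x
  have h := congrArg (fun y => (Ψ' y).coeff 0) hcb
  simp only [map_mul, mul_coeff_zero, hB, coeff_map, hφ] at h
  exact mul_left_cancel₀ (fun h => hc (Subtype.ext h)) (h.trans (congrArg Subtype.val hcb).symm)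

/-- An additive map satisfying the Leibniz rule along an injective ring homomorphism into a domain
vanishes as soon as it vanishes on a subring with the same fractions. -/
theorem eq_zero_of_leibniz_of_fractions {B R S : Type*} [CommRing B] [CommRing R] [CommRing S]
    [IsDomain S] (f : R →+* S) (hf : Function.Injective f) (E : R →+ S)
    (hE : ∀ x y, E (x * y) = f x * E y + f y * E x) (j : B →+* R)
    (hj : ∀ x : R, ∃ c b : B, j c ≠ 0 ∧ j c * x = j b) (h0 : ∀ b, E (j b) = 0) (x : R) :
    E x = 0 := by
  obtain ⟨c, b, hc, hcb⟩ := hj x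
  have h := hE (j c) x
  rw [hcb, h0, h0, mul_zero, add_zero] at h
  exact (mul_eq_zero.mp h.symm).resolve_left ((map_ne_zero_iff f hf).mpr hc)

/-- An additive map satisfying the Leibniz rule vanishes on `A[X]/(p)` if it vanishes on `A` and
on the root of `p`. -/
theorem AdjoinRoot.eq_zero_of_leibniz {A S : Type*} [CommRing A] [CommRing S] {p : A[X]}
    (f : AdjoinRoot p →+* S) (E : AdjoinRoot p →+ S)
    (hE : ∀ x y, E (x * y) = f x * E y + f y * E x) (hof : ∀ a, E (AdjoinRoot.of p a) = 0)
    (hroot : E (AdjoinRoot.root p) = 0) (x : AdjoinRoot p) : E x = 0 := by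
  have hpow : ∀ i, E (AdjoinRoot.root p ^ i) = 0 := by
    intro i
    induction i with
    | zero => simpa using hof 1
    | succ i ih => rw [pow_succ, hE, ih, hroot]; simp
  induction x using AdjoinRoot.induction_on with
  | ih q =>
    induction q using Polynomial.induction_on' with
    | add q r hq hr => rw [map_add, map_add, hq, hr, add_zero]
    | monomial i a =>
      rw [← C_mul_X_pow_eq_monomial, map_mul, map_pow, AdjoinRoot.mk_C, AdjoinRoot.mk_X, hE, hof,
        hpow]
      simp

/-- A `k`-derivation of `B` whose exponential is the ring homomorphism `φ : B → B[t]` extends to a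
locally nilpotent derivation of the integral closure of `B` in its field of fractions. -/
theorem exists_locallyNilpotent_derivation_integralClosure {k B K : Type*} [CommRing k]
    [CommRing B] [IsDomain B] [Field K] [CharZero K] [Algebra k B] [Algebra k K] [Algebra B K]
    [IsScalarTower k B K]
    [IsFractionRing B K] (φ : B →+* B[X]) (hφ : ∀ b, (φ b).coeff 0 = b)
    (hder : ∀ b, derivative (φ b) = φ ((φ b).coeff 1))
    (hk : ∀ c : k, φ (algebraMap k B c) = C (algebraMap k B c)) :
    ∃ D : Derivation k (Subalgebra.restrictScalars k (integralClosure B K))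
        (Subalgebra.restrictScalars k (integralClosure B K)),
      (∀ x, ∃ m : ℕ, (⇑D)^[m] x = 0) ∧
      ∀ (x : Subalgebra.restrictScalars k (integralClosure B K)) (b : B),
        (x : K) = algebraMap B K b → (D x : K) = algebraMap B K ((φ b).coeff 1) := by
  obtain ⟨Ψ, hB, h0, hint⟩ := exists_ringHom_polynomial_integralClosure (K := K) φ hφ
  have hmul1 : ∀ x y, (Ψ (x * y)).coeff 1 = x * (Ψ y).coeff 1 + y * (Ψ x).coeff 1 := by
    intro x y
    rw [map_mul, mul_coeff_one, h0, h0]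
    ring
  let E : integralClosure B K →+ integralClosure B K :=
    { toFun := fun x => ⟨(Ψ x).coeff 1, hint x 1⟩
      map_zero' := by ext; simp
      map_add' := fun x y => by ext; simp }
  have hEmul : ∀ x y, E (x * y) = x * E y + y * E x := fun x y => Subtype.ext (hmul1 x y)
  have hEB : ∀ b, E (algebraMap B _ b) = algebraMap B _ ((φ b).coeff 1) := by
    intro b
    ext
    change (Ψ (algebraMap B _ b)).coeff 1 = _
    rw [hB, coeff_map]
    rfl
  have hΨinj : Function.Injective Ψ := fun x y h => by
    ext
    rw [← h0, h, h0]
  have hΨE : ∀ x, derivative (Ψ x) = Ψ (E x) := by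
    intro x
    let F : integralClosure B K →+ K[X] :=
      (derivative : K[X] →ₗ[K] K[X]).toAddMonoidHom.comp Ψ.toAddMonoidHom -
        Ψ.toAddMonoidHom.comp E
    have hF : ∀ y, F y = derivative (Ψ y) - Ψ (E y) := fun y => rfl
    rw [← sub_eq_zero, ← hF]
    refine eq_zero_of_leibniz_of_fractions Ψ hΨinj F (fun x y => ?_)
      (algebraMap B (integralClosure B K)) exists_mul_eq_algebraMap_integralClosure
      (fun b => ?_) x
    · simp only [hF, hEmul, map_mul, map_add, derivative_mul]
      ring
    · rw [hF, hEB, hB, hB, derivative_map, hder, sub_self]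
  have hnil : ∀ m x, (∀ i, m ≤ i → (Ψ x).coeff i = 0) → E^[m] x = 0 := by
    intro m
    induction m with
    | zero =>
      intro x hx
      apply hΨinj
      ext i
      simpa using hx i i.zero_le
    | succ m ih =>
      intro x hx
      rw [Function.iterate_succ_apply]
      refine ih _ fun i hi => ?_
      rw [← hΨE, coeff_derivative, hx _ (Nat.succ_le_succ hi), zero_mul]
  have hEk : ∀ c : k, E (algebraMap B _ (algebraMap k B c)) = 0 := fun c => by
    rw [hEB, hk, coeff_C_of_ne_zero one_ne_zero, map_zero]
  have hEsmul : ∀ (c : k) (x : integralClosure B K), E (c • x) = c • E x := by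
    have hc : ∀ (c : k) (y : integralClosure B K),
        c • y = algebraMap B (integralClosure B K) (algebraMap k B c) * y := by
      intro c y
      ext
      change c • (y : K) = algebraMap B K (algebraMap k B c) * y
      rw [← IsScalarTower.algebraMap_apply, Algebra.smul_def]
    intro c x
    rw [hc, hEmul, hEk, mul_zero, add_zero, hc]
  let L : Subalgebra.restrictScalars k (integralClosure B K) →ₗ[k]
      Subalgebra.restrictScalars k (integralClosure B K) :=
    { toFun := E
      map_add' := E.map_add
      map_smul' := hEsmul }
  refine ⟨Derivation.mk' L hEmul, fun x => ⟨(Ψ x).natDegree + 1, hnil _ _ fun i hi =>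
    coeff_eq_zero_of_natDegree_lt hi⟩, fun x b hx => ?_⟩
  have hx' : (⟨x, x.2⟩ : integralClosure B K) = algebraMap B (integralClosure B K) b :=
    Subtype.ext hx
  exact congrArg Subtype.val ((congrArg E hx').trans (hEB b))

/-- Let `A` be a normal (integrally closed) finitely generated domain over `ℂ`
and `D` a nonzero locally nilpotent `ℂ`-derivation of `A`.  Let `v ∈ ker D` be nonzero and
`n ≥ 1` with `X ^ n - C v` irreducible over `A`, so that `B = A[X]/(Xⁿ - v)` is a domain.  Let
`K` be the field of fractions of `B` and `A'` the integral closure of `B` in `K`, and let `u'`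
be the image in `A'` of the root `X` of `Xⁿ - v`.  Then `D` extends uniquely to a locally
nilpotent `ℂ`-derivation `D'` of `A'` with `D' u' = 0`. -/
theorem derivation_extends_to_integral_closure_of_cyclic_cover
    {A : Type*} [CommRing A] [IsDomain A] [Algebra ℂ A]
    [Algebra.FiniteType ℂ A] [IsIntegrallyClosed A]
    (D : Derivation ℂ A A) (hD : D.IsLocallyNilpotent) (hne : D ≠ 0)
    (v : A) (hv : v ≠ 0) (hker : D v = 0) (n : ℕ) (hn : 1 ≤ n)
    (hirr : Irreducible (X ^ n - C v : Polynomial A))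
    [IsDomain (AdjoinRoot (X ^ n - C v : Polynomial A))]
    (K : Type*) [Field K] [Algebra ℂ K]
    [Algebra (AdjoinRoot (X ^ n - C v : Polynomial A)) K]
    [IsScalarTower ℂ (AdjoinRoot (X ^ n - C v : Polynomial A)) K]
    [IsFractionRing (AdjoinRoot (X ^ n - C v : Polynomial A)) K]
    (A' : Subalgebra ℂ K)
    (hA' : A' = Subalgebra.restrictScalars ℂ
      (integralClosure (AdjoinRoot (X ^ n - C v : Polynomial A)) K))
    (u' : A')
    (hu' : (u' : K) = algebraMap (AdjoinRoot (X ^ n - C v : Polynomial A)) K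
      (AdjoinRoot.root (X ^ n - C v : Polynomial A)))
    (ι : A → A')
    (hι : ∀ a : A, (ι a : K) = algebraMap (AdjoinRoot (X ^ n - C v : Polynomial A)) K
      (AdjoinRoot.of (X ^ n - C v : Polynomial A) a)) :
    ∃! D' : Derivation ℂ A' A',
      (∀ f, ∃ m : ℕ, (⇑D')^[m] f = 0) ∧ D' u' = 0 ∧
        ∀ a : A, D' (ι a) = ι (D a) := by
  subst hA'
  obtain ⟨φA, hφA, hφAder⟩ := D.exists_exp_ringHom hD
  have hφA0 : ∀ a, (φA a).coeff 0 = a := fun a => by simp [hφA]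
  have hφA1 : ∀ a, (φA a).coeff 1 = D a := fun a => by simp [hφA]
  have : CharZero A := charZero_of_injective_algebraMap (algebraMap ℂ A).injective
  have hφAC : ∀ a, D a = 0 → φA a = C a := by
    intro a ha
    have h := derivative_eq_zero.mp (show derivative (φA a) = 0 by rw [hφAder, ha, map_zero])
    rw [eq_C_of_natDegree_eq_zero h, hφA0]
  generalize hp : (X ^ n - C v : A[X]) = p at *
  let φ : AdjoinRoot p →+* (AdjoinRoot p)[X] :=
    AdjoinRoot.lift ((mapRingHom (AdjoinRoot.of p)).comp φA) (C (AdjoinRoot.root p)) (by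
      have h := AdjoinRoot.eval₂_root p
      rw [← hp] at h ⊢
      simp only [eval₂_sub, eval₂_X_pow, eval₂_C, RingHom.comp_apply, hφAC v hker,
        coe_mapRingHom, map_C] at h ⊢
      rw [← C_pow, ← C_sub, h, C_0])
  have hφof : ∀ a, φ (AdjoinRoot.of p a) = (φA a).map (AdjoinRoot.of p) := fun a =>
    AdjoinRoot.lift_of _
  have hφroot : φ (AdjoinRoot.root p) = C (AdjoinRoot.root p) := AdjoinRoot.lift_root _
  have hφ0 : ∀ b, (φ b).coeff 0 = b := by
    have h : (constantCoeff.comp φ) = RingHom.id _ := by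
      apply AdjoinRoot.ringHom_ext
      · ext a
        simp [hφof, hφA0]
      · simp [hφroot]
    exact fun b => DFunLike.congr_fun h b
  have hφder : ∀ b, derivative (φ b) = φ ((φ b).coeff 1) := by
    intro b
    let F : AdjoinRoot p →+ (AdjoinRoot p)[X] :=
      (derivative : (AdjoinRoot p)[X] →ₗ[AdjoinRoot p] _).toAddMonoidHom.comp φ.toAddMonoidHom -
        φ.toAddMonoidHom.comp ((lcoeff (AdjoinRoot p) 1).toAddMonoidHom.comp φ.toAddMonoidHom)
    have hF : ∀ y, F y = derivative (φ y) - φ ((φ y).coeff 1) := fun y => rfl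
    rw [← sub_eq_zero, ← hF]
    refine AdjoinRoot.eq_zero_of_leibniz φ F (fun x y => ?_) (fun a => ?_) ?_ b
    · simp only [hF, map_mul, mul_coeff_one, hφ0, map_add, derivative_mul]
      ring
    · rw [hF, hφof, coeff_map, hφA1, hφof, derivative_map, hφAder, sub_self]
    · rw [hF, hφroot, derivative_C, coeff_C_of_ne_zero one_ne_zero, map_zero, sub_zero]
  have : CharZero K := charZero_of_injective_algebraMap (algebraMap ℂ K).injective
  obtain ⟨D', hnil, hD'⟩ := exists_locallyNilpotent_derivation_integralClosure (k := ℂ) (K := K)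
    φ hφ0 hφder (fun c => by
      have hc : algebraMap ℂ (AdjoinRoot p) c = AdjoinRoot.of p (algebraMap ℂ A c) := rfl
      rw [hc, hφof, hφAC _ (D.map_algebraMap c), map_C])
  have hD'u : D' u' = 0 := by
    ext
    rw [hD' u' _ hu', hφroot, coeff_C_of_ne_zero one_ne_zero, map_zero]
    rfl
  have hD'ι : ∀ a, D' (ι a) = ι (D a) := fun a => by
    ext
    rw [hD' _ _ (hι a), hφof, coeff_map, hφA1, hι]
  refine ⟨D', ⟨hnil, hD'u, hD'ι⟩, fun D₂ ⟨_, hD₂u, hD₂ι⟩ => ?_⟩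
  let E : integralClosure (AdjoinRoot p) K →+ integralClosure (AdjoinRoot p) K :=
    (D₂ - D').toLinearMap.toAddMonoidHom
  have hE : ∀ x y, E (x * y) = x * E y + y * E x := (D₂ - D').leibniz
  let j : AdjoinRoot p →+* integralClosure (AdjoinRoot p) K := algebraMap _ _
  have hjof : ∀ a, j (AdjoinRoot.of p a) = ι a := fun a => Subtype.ext (hι a).symm
  have hjroot : j (AdjoinRoot.root p) = u' := Subtype.ext hu'.symm
  have hEj : ∀ b, E (j b) = 0 := by
    refine AdjoinRoot.eq_zero_of_leibniz j (E.comp j.toAddMonoidHom) (fun x y => ?_)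
      (fun a => ?_) ?_
    · exact (congrArg E (map_mul j x y)).trans (hE _ _)
    · refine (congrArg E (hjof a)).trans ?_
      exact sub_eq_zero.mpr ((hD₂ι a).trans (hD'ι a).symm)
    · refine (congrArg E hjroot).trans ?_
      exact sub_eq_zero.mpr (hD₂u.trans hD'u.symm)
  ext1 x
  exact sub_eq_zero.mp (eq_zero_of_leibniz_of_fractions (RingHom.id _) Function.injective_id E hE j
    exists_mul_eq_algebraMap_integralClosure hEj x)
end

section
/- Let A = ⊕_{i∈ℤ} A_i be a ℤ-graded commutative ℂ-algebra and let k ≤ l be integers. Suppose ∂ = ∂_k + ∂_{k+1} + ... + ∂_l is a ℂ-derivation of A, where each ∂_i is a ℂ-derivation of A that is homogeneous of degree i (i.e., ∂_i(A_n) ⊆ A_{n+i} for all n ∈ ℤ). If ∂ is locally nilpotent, then ∂_k and ∂_l are locally nilpotent. -/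
/-- Taking homogeneous components intertwines with an additive map that is homogeneous of
degree `j`. -/
theorem DirectSum.decompose_map_of_homogeneous {A σ F : Type*} [AddCommGroup A] [SetLike σ A]
    [AddSubmonoidClass σ A] (𝒜 : ℤ → σ) [DirectSum.Decomposition 𝒜] [FunLike F A A]
    [AddMonoidHomClass F A A] (d : F) (j : ℤ) (hd : ∀ n : ℤ, ∀ a ∈ 𝒜 n, d a ∈ 𝒜 (n + j))
    (g : A) (i : ℤ) :
    (DirectSum.decompose 𝒜 (d g) i : A) = d (DirectSum.decompose 𝒜 g (i - j)) := by
  induction g using DirectSum.Decomposition.inductionOn 𝒜 with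
  | zero => simp
  | @homogeneous n a =>
    by_cases h : n + j = i
    · subst h
      rw [DirectSum.decompose_of_mem_same 𝒜 (hd n a a.2), add_sub_cancel_right,
        DirectSum.decompose_of_mem_same 𝒜 a.2]
    · rw [DirectSum.decompose_of_mem_ne 𝒜 (hd n a a.2) h,
        DirectSum.decompose_of_mem_ne 𝒜 a.2 (by omega), map_zero]
  | add a b ha hb => simp [DirectSum.decompose_add, ha, hb]

/-- If `e` is extreme (maximal for `ε = 1`, minimal for `ε = -1`) among the degrees of the
homogeneous components of `D`, then the extreme component of `D^[n] f`, for `f` homogeneous of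
degree `m`, is `(Dc e)^[n] f`. -/
theorem Derivation.decompose_iterate_sum_of_extreme
    {A : Type*} [CommRing A] [Algebra ℂ A] (𝒜 : ℤ → Submodule ℂ A) [GradedAlgebra 𝒜]
    (s : Finset ℤ) (Dc : ℤ → Derivation ℂ A A)
    (hhom : ∀ i : ℤ, ∀ n : ℤ, ∀ a ∈ 𝒜 n, Dc i a ∈ 𝒜 (n + i))
    (ε : ℤ) (hε : ε = 1 ∨ ε = -1) (e : ℤ) (he : e ∈ s) (hs : ∀ i ∈ s, ε * i ≤ ε * e)
    (m : ℤ) (f : A) (hf : f ∈ 𝒜 m) (n : ℕ) (i : ℤ) (hi : ε * (m + n * e) ≤ ε * i) :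
    (DirectSum.decompose 𝒜 ((⇑(∑ j ∈ s, Dc j))^[n] f) i : A) =
      if i = m + n * e then (Dc e)^[n] f else 0 := by
  induction n generalizing i with
  | zero =>
    split_ifs with h
    · simp only [Nat.cast_zero, zero_mul, add_zero] at h
      subst h
      exact DirectSum.decompose_of_mem_same 𝒜 hf
    · exact DirectSum.decompose_of_mem_ne 𝒜 hf (by simpa [eq_comm] using h)
  | succ n ih =>
    have hn : ((n + 1 : ℕ) : ℤ) * e = n * e + e := by push_cast; ring
    rw [hn] at hi ⊢
    have key : ∀ j ∈ s, (DirectSum.decompose 𝒜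
        (Dc j ((⇑(∑ j ∈ s, Dc j))^[n] f)) i : A) =
          if j = e then (if i = m + (n * e + e) then (Dc e)^[n + 1] f else 0) else 0 := by
      intro j hj
      have hje := hs j hj
      rw [DirectSum.decompose_map_of_homogeneous 𝒜 (Dc j) j (hhom j), ih (i - j)
        (by rcases hε with rfl | rfl <;> linarith)]
      by_cases h : j = e
      · subst h
        simp only [if_true, sub_eq_iff_eq_add, add_assoc, Function.iterate_succ_apply']
        split_ifs <;> simp
      · rw [if_neg h, if_neg, map_zero]
        intro h'
        apply h
        rcases hε with rfl | rfl <;> linarith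
    have hsum : ∀ g : A, (∑ j ∈ s, Dc j) g = ∑ j ∈ s, Dc j g := fun g => by
      exact (congrFun (map_sum Derivation.coeFnAddMonoidHom Dc s) g).trans (Finset.sum_apply g s _)
    rw [Function.iterate_succ_apply', hsum, DirectSum.decompose_sum, DFinsupp.finsetSum_apply,
      AddSubmonoidClass.coe_finsetSum, Finset.sum_congr rfl key, Finset.sum_ite_eq' s e,
      if_pos he]

/-- A derivation is locally nilpotent as soon as it is nilpotent on homogeneous elements. -/
theorem Derivation.IsLocallyNilpotent.of_homogeneous
    {A : Type*} [CommRing A] [Algebra ℂ A] (𝒜 : ℤ → Submodule ℂ A) [GradedAlgebra 𝒜]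
    (D : Derivation ℂ A A) (h : ∀ m : ℤ, ∀ f ∈ 𝒜 m, ∃ n : ℕ, (⇑D)^[n] f = 0) :
    D.IsLocallyNilpotent := by
  intro f
  induction f using DirectSum.Decomposition.inductionOn 𝒜 with
  | zero => exact ⟨0, rfl⟩
  | @homogeneous m a => exact h m a a.2
  | add a b ha hb =>
    obtain ⟨p, hp⟩ := ha
    obtain ⟨q, hq⟩ := hb
    refine ⟨p + q, ?_⟩
    rw [iterate_map_add, add_comm p q, Function.iterate_add_apply, hp, add_comm q p,
      Function.iterate_add_apply, hq, iterate_map_zero, iterate_map_zero, add_zero]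

/-- An extreme homogeneous component of a locally nilpotent derivation is locally nilpotent. -/
theorem Derivation.IsLocallyNilpotent.of_sum_of_extreme
    {A : Type*} [CommRing A] [Algebra ℂ A] (𝒜 : ℤ → Submodule ℂ A) [GradedAlgebra 𝒜]
    (s : Finset ℤ) (Dc : ℤ → Derivation ℂ A A)
    (hhom : ∀ i : ℤ, ∀ n : ℤ, ∀ a ∈ 𝒜 n, Dc i a ∈ 𝒜 (n + i))
    (hD : (∑ i ∈ s, Dc i).IsLocallyNilpotent)
    (ε : ℤ) (hε : ε = 1 ∨ ε = -1) (e : ℤ) (he : e ∈ s) (hs : ∀ i ∈ s, ε * i ≤ ε * e) :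
    (Dc e).IsLocallyNilpotent := by
  refine .of_homogeneous 𝒜 _ fun m f hf => ?_
  obtain ⟨n, hn⟩ := hD f
  refine ⟨n, ?_⟩
  have := Derivation.decompose_iterate_sum_of_extreme 𝒜 s Dc hhom ε hε e he hs m f hf n
    (m + n * e) le_rfl
  rw [hn, if_pos rfl] at this
  simpa using this.symm

/-- Let `A = ⊕_{i ∈ ℤ} A_i` be a `ℤ`-graded commutative `ℂ`-algebra and
`k ≤ l` integers.  If `D = D_k + ⋯ + D_l` is a locally nilpotent `ℂ`-derivation of `A`, where
each `D_i` is a `ℂ`-derivation homogeneous of degree `i`, then `D_k` and `D_l` are locally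
nilpotent. -/
theorem extreme_homogeneous_components_locally_nilpotent
    {A : Type*} [CommRing A] [Algebra ℂ A]
    (𝒜 : ℤ → Submodule ℂ A) [GradedAlgebra 𝒜]
    (k l : ℤ) (hkl : k ≤ l)
    (Dc : ℤ → Derivation ℂ A A)
    (hhom : ∀ i : ℤ, ∀ n : ℤ, ∀ a ∈ 𝒜 n, Dc i a ∈ 𝒜 (n + i))
    (D : Derivation ℂ A A)
    (hsum : D = ∑ i ∈ Finset.Icc k l, Dc i)
    (hD : D.IsLocallyNilpotent) :
    (Dc k).IsLocallyNilpotent ∧ (Dc l).IsLocallyNilpotent := by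
  subst hsum
  constructor
  · refine .of_sum_of_extreme 𝒜 _ Dc hhom hD (-1) (.inr rfl) k (by simpa using hkl) ?_
    intro i hi
    have := (Finset.mem_Icc.mp hi).1
    linarith
  · refine .of_sum_of_extreme 𝒜 _ Dc hhom hD 1 (.inl rfl) l (by simpa using hkl) ?_
    intro i hi
    have := (Finset.mem_Icc.mp hi).2
    linarith
end

section
/- Equip the polynomial ring ℂ[X,Y] with the weighted grading determined by deg X = d_X > 0 and deg Y = d_Y > 0. Let ∂ be a nonzero locally nilpotent ℂ-derivation of ℂ[X,Y] that is homogeneous of some degree e₀ with respect to this grading. Then there exist a graded ℂ-algebra automorphism φ of ℂ[X,Y] (preserving the weighted grading, possibly after interchanging the roles of X and Y) and an integer e ≥ 0 such that the conjugate derivation φ⁻¹∘∂∘φ satisfies (φ⁻¹∘∂∘φ)(X) = 0 and (φ⁻¹∘∂∘φ)(Y) = X^e. -/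
open MvPolynomial

namespace Derivation

section NilpotencyDegree

variable {A : Type*} [CommRing A] [Algebra ℂ A] {D : Derivation ℂ A A} {f g : A} {m n : ℕ}

/-- `D.HasNilpotencyDegree f n` says that `n` is the largest exponent with `D^[n] f ≠ 0`. -/
def HasNilpotencyDegree (D : Derivation ℂ A A) (f : A) (n : ℕ) : Prop :=
  (⇑D)^[n] f ≠ 0 ∧ (⇑D)^[n + 1] f = 0

theorem iterate_add_mul_of_iterate_succ_eq_zero (hf : (⇑D)^[m + 1] f = 0)
    (hg : (⇑D)^[n + 1] g = 0) :
    (⇑D)^[m + n] (f * g) = (m + n).choose m • ((⇑D)^[m] f * (⇑D)^[n] g) := by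
  obtain ⟨k, hk⟩ : ∃ k, m + n = k := ⟨_, rfl⟩
  induction k generalizing m n f g with
  | zero =>
    obtain ⟨rfl, rfl⟩ : m = 0 ∧ n = 0 := by omega
    simp
  | succ k ih =>
    have key : (⇑D)^[m + n] (f * g) = (⇑D)^[k] (f * D g) + (⇑D)^[k] (D f * g) := by
      rw [hk, Function.iterate_succ_apply, leibniz, iterate_map_add, smul_eq_mul, smul_eq_mul,
        mul_comm g]
    rw [key]
    cases m with
    | zero =>
      have hDf : D f = 0 := hf
      obtain ⟨n, rfl⟩ : ∃ j, n = j + 1 := ⟨k, by omega⟩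
      obtain rfl : n = k := by omega
      have := ih hf (g := D g) (n := n) hg (by omega)
      simp_all
    | succ m =>
      cases n with
      | zero =>
        have hDg : D g = 0 := hg
        obtain rfl : m = k := by omega
        have := ih (f := D f) (m := m) hf hg (by omega)
        simp_all
      | succ n =>
        have h1 := ih hf (g := D g) (n := n) hg (by omega)
        have h2 := ih (f := D f) (m := m) hf hg (by omega)
        rw [show m + 1 + n = k by omega] at h1
        rw [show m + (n + 1) = k by omega] at h2
        rw [h1, h2, hk, Nat.choose_succ_succ, add_smul, add_comm, Function.iterate_succ_apply,
          Function.iterate_succ_apply]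

theorem IsLocallyNilpotent.exists_hasNilpotencyDegree (hD : D.IsLocallyNilpotent) (hf : f ≠ 0) :
    ∃ n, D.HasNilpotencyDegree f n := by
  classical
  have h := hD f
  have hpos : Nat.find h ≠ 0 := fun h0 => hf (by simpa [h0] using Nat.find_spec h)
  obtain ⟨k, hk⟩ := Nat.exists_eq_succ_of_ne_zero hpos
  refine ⟨k, Nat.find_min h (by omega), ?_⟩
  have := Nat.find_spec h
  rwa [hk] at this

theorem HasNilpotencyDegree.eq (hm : D.HasNilpotencyDegree f m) (hn : D.HasNilpotencyDegree f n) :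
    m = n := by
  have key : ∀ {a b : ℕ}, D.HasNilpotencyDegree f a → D.HasNilpotencyDegree f b → ¬ a < b := by
    intro a b ha hb hab
    obtain ⟨c, rfl⟩ := Nat.exists_eq_add_of_lt hab
    apply hb.1
    rw [show a + c + 1 = c + (a + 1) by ring, Function.iterate_add_apply, ha.2, iterate_map_zero]
  exact le_antisymm (not_lt.1 (key hn hm)) (not_lt.1 (key hm hn))

theorem hasNilpotencyDegree_zero_iff : D.HasNilpotencyDegree f 0 ↔ f ≠ 0 ∧ D f = 0 := Iff.rfl

theorem hasNilpotencyDegree_apply_iff :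
    D.HasNilpotencyDegree (D f) n ↔ D.HasNilpotencyDegree f (n + 1) := Iff.rfl

theorem HasNilpotencyDegree.mul [IsDomain A] (hm : D.HasNilpotencyDegree f m)
    (hn : D.HasNilpotencyDegree g n) : D.HasNilpotencyDegree (f * g) (m + n) := by
  have : CharZero A := charZero_of_injective_algebraMap (FaithfulSMul.algebraMap_injective ℂ A)
  constructor
  · rw [iterate_add_mul_of_iterate_succ_eq_zero hm.2 hn.2, nsmul_eq_mul]
    exact mul_ne_zero (Nat.cast_ne_zero.2 (Nat.choose_pos (by omega)).ne') (mul_ne_zero hm.1 hn.1)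
  · have := iterate_add_mul_of_iterate_succ_eq_zero (D := D) (m := m + 1) (f := f) (n := n) (g := g)
      (by rw [Function.iterate_succ_apply', hm.2, map_zero]) hn.2
    rw [show m + n + 1 = m + 1 + n by ring, this, hm.2]
    simp

theorem IsLocallyNilpotent.le_of_dvd [IsDomain A] (hD : D.IsLocallyNilpotent) (hfg : f ∣ g)
    (hm : D.HasNilpotencyDegree f m) (hn : D.HasNilpotencyDegree g n) : m ≤ n := by
  obtain ⟨h, rfl⟩ := hfg
  have hh : h ≠ 0 := by
    rintro rfl
    exact hn.1 (by simp)
  obtain ⟨k, hk⟩ := hD.exists_hasNilpotencyDegree hh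
  have := hn.eq (hm.mul hk)
  omega

theorem IsLocallyNilpotent.apply_eq_zero_of_dvd_s5 [IsDomain A] (hD : D.IsLocallyNilpotent)
    (hg : g ≠ 0) (hDg : D g = 0) (hfg : f ∣ g) : D f = 0 := by
  obtain ⟨m, hm⟩ := hD.exists_hasNilpotencyDegree (ne_zero_of_dvd_ne_zero hg hfg)
  obtain rfl : m = 0 := by
    simpa using hD.le_of_dvd hfg hm (hasNilpotencyDegree_zero_iff.2 ⟨hg, hDg⟩)
  exact hm.2

theorem IsLocallyNilpotent.apply_eq_zero_or_of_dvd_of_dvd [IsDomain A]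
    (hD : D.IsLocallyNilpotent) (hfg : f ∣ D g) (hgf : g ∣ D f) : D f = 0 ∨ D g = 0 := by
  by_contra! h
  obtain ⟨m, hm⟩ := hD.exists_hasNilpotencyDegree h.1
  obtain ⟨n, hn⟩ := hD.exists_hasNilpotencyDegree h.2
  have h1 := hD.le_of_dvd hfg (hasNilpotencyDegree_apply_iff.1 hm) hn
  have h2 := hD.le_of_dvd hgf (hasNilpotencyDegree_apply_iff.1 hn) hm
  omega

theorem IsLocallyNilpotent.apply_eq_zero_of_dvd_apply [IsDomain A] (hD : D.IsLocallyNilpotent)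
    (hf : f ∣ D f) : D f = 0 :=
  (hD.apply_eq_zero_or_of_dvd_of_dvd hf hf).elim id id

end NilpotencyDegree

section Conj

variable {A : Type*} [CommRing A] [Algebra ℂ A]

/-- The conjugate `φ⁻¹ ∘ D ∘ φ` of a derivation by an algebra automorphism. -/
def conj (D : Derivation ℂ A A) (φ : A ≃ₐ[ℂ] A) : Derivation ℂ A A :=
  Derivation.mk' (φ.symm.toLinearMap ∘ₗ D.toLinearMap ∘ₗ φ.toLinearMap) fun a b => by
    simp

@[simp]
theorem conj_apply (D : Derivation ℂ A A) (φ : A ≃ₐ[ℂ] A) (a : A) :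
    D.conj φ a = φ.symm (D (φ a)) := rfl

theorem IsLocallyNilpotent.conj {D : Derivation ℂ A A} (hD : D.IsLocallyNilpotent)
    (φ : A ≃ₐ[ℂ] A) : (D.conj φ).IsLocallyNilpotent := by
  intro f
  obtain ⟨n, hn⟩ := hD (φ f)
  have h : Function.Semiconj φ (D.conj φ) D := fun x => by simp
  exact ⟨n, φ.injective (by rw [h.iterate_right n f, hn, map_zero])⟩

theorem conj_ne_zero {D : Derivation ℂ A A} (hD : D ≠ 0) (φ : A ≃ₐ[ℂ] A) : D.conj φ ≠ 0 := by
  contrapose! hD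
  ext a
  simpa using DFunLike.congr_fun hD (φ.symm a)

end Conj

end Derivation

namespace MvPolynomial

theorem IsWeightedHomogeneous.aeval {R M σ τ : Type*} [CommSemiring R] [AddCommMonoid M]
    {w : σ → M} {v : τ → M} {f : σ → MvPolynomial τ R}
    (hf : ∀ k, (f k).IsWeightedHomogeneous v (w k)) {p : MvPolynomial σ R} {n : M}
    (hp : p.IsWeightedHomogeneous w n) : (aeval f p).IsWeightedHomogeneous v n := by
  rw [aeval_def, eval₂_eq]
  refine IsWeightedHomogeneous.sum _ _ _ fun d hd => ?_
  have h := IsWeightedHomogeneous.prod d.support (fun k => f k ^ d k) (fun k => d k • w k)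
    fun k _ => (hf k).pow _
  have hw : ∑ k ∈ d.support, d k • w k = n := hp (mem_support_iff.1 hd)
  rw [hw] at h
  exact h.C_mul _

section TwoVariables

variable {R : Type*} [CommRing R] {i j : Fin 2} {w : Fin 2 → ℤ} {n : ℤ}
  {p : MvPolynomial (Fin 2) R}

theorem weight_fin_two (hij : i ≠ j) (d : Fin 2 →₀ ℕ) :
    Finsupp.weight w d = d i * w i + d j * w j := by
  rw [Finsupp.weight_apply, Finsupp.sum_fintype _ _ (by simp), Fin.sum_univ_two]
  fin_cases i <;> fin_cases j <;> simp_all [add_comm]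

theorem monomial_eq_mul_pow_mul_pow (hij : i ≠ j) (d : Fin 2 →₀ ℕ) (r : R) :
    monomial d r = C r * X i ^ d i * X j ^ d j := by
  rw [monomial_eq, Finsupp.prod_fintype _ _ (by simp), Fin.prod_univ_two]
  fin_cases i <;> fin_cases j <;> simp_all [mul_assoc, mul_left_comm, mul_comm]

theorem IsWeightedHomogeneous.exists_eq_C_mul_X_pow (hij : i ≠ j) (hw : 0 < w i)
    (hp : p.IsWeightedHomogeneous w n) (hj : ∀ d, coeff d p ≠ 0 → d j = 0) :
    ∃ (c : R) (m : ℕ), p = C c * X i ^ m ∧ (c ≠ 0 → m * w i = n) := by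
  by_cases h0 : p = 0
  · exact ⟨0, 0, by simp [h0]⟩
  obtain ⟨d₀, hd₀⟩ := ne_zero_iff.1 h0
  have hw₀ := hp hd₀
  rw [weight_fin_two hij, hj _ hd₀] at hw₀
  refine ⟨coeff d₀ p, d₀ i, ?_, fun _ => by simpa using hw₀⟩
  have hmon : p = monomial d₀ (coeff d₀ p) := by
    ext d
    rw [coeff_monomial]
    split_ifs with h
    · rw [h]
    by_contra hd
    apply h
    have hwd := hp hd
    rw [weight_fin_two hij, hj _ hd, ← hw₀] at hwd
    have hi : d₀ i = d i := by
      have := mul_right_cancel₀ hw.ne' (add_right_cancel hwd)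
      exact_mod_cast this.symm
    have hj' : d₀ j = d j := by rw [hj _ hd, hj _ hd₀]
    ext k
    obtain rfl | rfl : k = i ∨ k = j := by omega
    · exact hi
    · exact hj'
  conv_lhs => rw [hmon, monomial_eq_mul_pow_mul_pow hij, hj _ hd₀, pow_zero, mul_one]

theorem IsWeightedHomogeneous.exists_eq_C_mul_X_pow_of_lt (hij : i ≠ j) (hw : ∀ k, 0 < w k)
    (hp : p.IsWeightedHomogeneous w n) (hn : n < w j) :
    ∃ (c : R) (m : ℕ), p = C c * X i ^ m ∧ (c ≠ 0 → m * w i = n) := by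
  refine hp.exists_eq_C_mul_X_pow hij (hw i) fun d hd => ?_
  have h := hp hd
  rw [weight_fin_two hij] at h
  by_contra hj
  have h1 : (1 : ℤ) ≤ d j := by exact_mod_cast Nat.one_le_iff_ne_zero.2 hj
  nlinarith [hw i, hw j, mul_nonneg (Nat.cast_nonneg (α := ℤ) (d i)) (hw i).le]

theorem apply_eq_mul_pderiv (hij : i ≠ j)
    (D : Derivation R (MvPolynomial (Fin 2) R) (MvPolynomial (Fin 2) R)) (hD : D (X i) = 0)
    (p : MvPolynomial (Fin 2) R) : D p = D (X j) * pderiv j p := by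
  have : D = D (X j) • pderiv j := by
    refine derivation_ext fun k => ?_
    obtain rfl | rfl : k = i ∨ k = j := by omega
    · simp [hD, pderiv_X_of_ne hij]
    · simp
  conv_lhs => rw [this]
  simp

theorem exists_support_apply_eq_zero_of_not_X_dvd {σ : Type*} {p : MvPolynomial σ R} {i : σ}
    (h : ¬ X i ∣ p) : ∃ d ∈ p.support, d i = 0 := by
  contrapose! h
  rw [p.as_sum]
  exact Finset.dvd_sum fun d hd => X_dvd_monomial.2 (Or.inr (h d hd))

end TwoVariables

section Triangular

variable {K : Type*} [Field K] {i j : Fin 2}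

theorem derivation_apply_C_mul {R σ : Type*} [CommSemiring R]
    (D : Derivation R (MvPolynomial σ R) (MvPolynomial σ R)) (a : R) (f : MvPolynomial σ R) :
    D (C a * f) = C a * D f := by
  rw [C_mul', D.map_smul, C_mul']

/-- The triangular automorphism fixing `X i` and sending `X j` to `s X j + q X i ^ m`. -/
noncomputable def triangularEquiv (hij : i ≠ j) {s : K} (hs : s ≠ 0) (q : K) (m : ℕ) :
    MvPolynomial (Fin 2) K ≃ₐ[K] MvPolynomial (Fin 2) K :=
  AlgEquiv.ofAlgHom
    (aeval (Function.update X j (C s * X j + C q * X i ^ m)))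
    (aeval (Function.update X j (C s⁻¹ * X j - C (s⁻¹ * q) * X i ^ m)))
    (by
      ext1 k
      obtain rfl | rfl : k = i ∨ k = j := by omega
      · simp [hij]
      · simp only [AlgHom.comp_apply, aeval_X, Function.update_self, map_sub, map_mul, map_pow,
          algHom_C, algebraMap_eq, ne_eq, hij, not_false_eq_true, Function.update_of_ne,
          AlgHom.id_apply]
        have : (C s⁻¹ * C s : MvPolynomial (Fin 2) K) = 1 := by
          rw [← C_mul, inv_mul_cancel₀ hs, C_1]
        linear_combination X k * this)
    (by
      ext1 k
      obtain rfl | rfl : k = i ∨ k = j := by omega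
      · simp [hij]
      · simp only [AlgHom.comp_apply, aeval_X, Function.update_self, map_add, map_mul, map_pow,
          algHom_C, algebraMap_eq, ne_eq, hij, not_false_eq_true, Function.update_of_ne,
          AlgHom.id_apply]
        have : (C s⁻¹ * C s : MvPolynomial (Fin 2) K) = 1 := by
          rw [← C_mul, inv_mul_cancel₀ hs, C_1]
        linear_combination (X k - C q * X i ^ m) * this)

variable (hij : i ≠ j) {s : K} (hs : s ≠ 0) (q : K) (m : ℕ)

@[simp]
theorem triangularEquiv_X_left : triangularEquiv hij hs q m (X i) = X i := by
  simp [triangularEquiv, hij]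

@[simp]
theorem triangularEquiv_X_right :
    triangularEquiv hij hs q m (X j) = C s * X j + C q * X i ^ m := by
  simp [triangularEquiv]

@[simp]
theorem triangularEquiv_symm_X_left : (triangularEquiv hij hs q m).symm (X i) = X i := by
  simp [triangularEquiv, hij]

variable {w : Fin 2 → ℤ} {n : ℤ} {p : MvPolynomial (Fin 2) K} {q m}

theorem IsWeightedHomogeneous.triangularEquiv (hw : q ≠ 0 → m * w i = w j)
    (hp : p.IsWeightedHomogeneous w n) :
    (triangularEquiv hij hs q m p).IsWeightedHomogeneous w n := by
  refine IsWeightedHomogeneous.aeval (fun k => ?_) hp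
  obtain rfl | rfl : k = i ∨ k = j := by omega
  · simpa [hij] using isWeightedHomogeneous_X K w k
  · rw [Function.update_self]
    refine ((isWeightedHomogeneous_X K w k).C_mul s).add ?_
    by_cases hq : q = 0
    · simpa [hq] using isWeightedHomogeneous_zero K w _
    · rw [← hw hq, ← nsmul_eq_mul]
      exact ((isWeightedHomogeneous_X K w i).pow m).C_mul q

theorem IsWeightedHomogeneous.triangularEquiv_symm (hw : q ≠ 0 → m * w i = w j)
    (hp : p.IsWeightedHomogeneous w n) :
    ((MvPolynomial.triangularEquiv hij hs q m).symm p).IsWeightedHomogeneous w n := by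
  refine IsWeightedHomogeneous.aeval (fun k => ?_) hp
  obtain rfl | rfl : k = i ∨ k = j := by omega
  · simpa [hij] using isWeightedHomogeneous_X K w k
  · rw [Function.update_self]
    refine ((isWeightedHomogeneous_X K w k).C_mul s⁻¹).sub ?_
    by_cases hq : q = 0
    · simpa [hq] using isWeightedHomogeneous_zero K w _
    · rw [← hw hq, ← nsmul_eq_mul]
      exact ((isWeightedHomogeneous_X K w i).pow m).C_mul _

end Triangular

end MvPolynomial

namespace MvPolynomial

theorem IsWeightedHomogeneous.exists_X_dvd_or_binomial_dvd {K : Type*} [Field K] [IsAlgClosed K]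
    {w : Fin 2 → ℤ} (hw : ∀ k, 0 < w k) {n : ℤ} (hn : 0 < n) {f : MvPolynomial (Fin 2) K}
    (hf : f.IsWeightedHomogeneous w n) :
    (∃ i, X i ∣ f) ∨ ∃ (q : K) (a b : ℕ), 0 < a ∧ 0 < b ∧ a * w 0 = b * w 1 ∧
      X 0 ^ a - C q * X 1 ^ b ∣ f := by
  by_cases h : ∃ i, X i ∣ f
  · exact Or.inl h
  right
  push Not at h
  obtain ⟨d₁, hd₁, hd₁0⟩ := exists_support_apply_eq_zero_of_not_X_dvd (h 0)
  obtain ⟨d₂, hd₂, hd₂1⟩ := exists_support_apply_eq_zero_of_not_X_dvd (h 1)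
  obtain ⟨u, hu⟩ := Int.eq_ofNat_of_zero_le (hw 0).le
  obtain ⟨v, hv⟩ := Int.eq_ofNat_of_zero_le (hw 1).le
  obtain ⟨b, a, hab, hub, hva⟩ := Nat.exists_coprime u v
  have hu0 : 0 < u := by have := hw 0; omega
  have hv0 : 0 < v := by have := hw 1; omega
  have hg0 : 0 < u.gcd v := Nat.gcd_pos_of_pos_left _ hu0
  have ha : 0 < a := Nat.pos_of_ne_zero fun h => by simp [h] at hva; omega
  have hb : 0 < b := Nat.pos_of_ne_zero fun h => by simp [h] at hub; omega
  have hweight : ∀ d ∈ f.support, (d 0 * u + d 1 * v : ℤ) = n := fun d hd => by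
    rw [← hf (mem_support_iff.1 hd), weight_fin_two (by decide : (0 : Fin 2) ≠ 1), hu, hv]
  have hweight' : ∀ d ∈ f.support, d 0 * b + d 1 * a = d₂ 0 * b := fun d hd => by
    have h2 := hweight d₂ hd₂
    rw [← hweight d hd, hd₂1] at h2
    have h3 : d₂ 0 * u = d 0 * u + d 1 * v := by
      rw [Nat.cast_zero, zero_mul, add_zero] at h2
      exact_mod_cast h2
    apply Nat.eq_of_mul_eq_mul_right hg0
    calc (d 0 * b + d 1 * a) * u.gcd v = d 0 * (b * u.gcd v) + d 1 * (a * u.gcd v) := by ring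
      _ = d₂ 0 * (b * u.gcd v) := by rw [← hub, ← hva, h3]
      _ = _ := by ring
  obtain ⟨m, hm⟩ : a ∣ d₂ 0 := by
    have h1 := hweight' d₁ hd₁
    rw [hd₁0, zero_mul, zero_add] at h1
    exact hab.symm.dvd_of_dvd_mul_right (Dvd.intro_left _ h1)
  have hm0 : m ≠ 0 := by
    rintro rfl
    have := hweight d₂ hd₂
    simp [hd₂1, hm] at this
    omega
  have hexp : ∀ d ∈ f.support, ∃ s t, d 0 = a * s ∧ d 1 = b * t ∧ s + t = m := fun d hd => by
    have h1 := hweight' d hd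
    rw [hm] at h1
    obtain ⟨s, hs⟩ : a ∣ d 0 := by
      refine hab.symm.dvd_of_dvd_mul_right ((Nat.dvd_add_left (dvd_mul_left a (d 1))).1 ?_)
      rw [h1, mul_assoc]
      exact dvd_mul_right _ _
    rw [hs] at h1
    have h2 : s * b + d 1 = m * b := by
      apply Nat.eq_of_mul_eq_mul_left ha
      linarith
    have hsm : s ≤ m := by
      refine Nat.le_of_mul_le_mul_right ?_ hb
      omega
    obtain ⟨t, rfl⟩ := Nat.exists_eq_add_of_le hsm
    refine ⟨s, t, hs, ?_, rfl⟩
    linarith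
  let P : Polynomial K := ∑ d ∈ f.support, Polynomial.C (coeff d f) * Polynomial.X ^ (d 0 / a)
  have hPm : P.coeff m = coeff d₂ f := by
    simp only [P, Polynomial.finsetSum_coeff, Polynomial.coeff_C_mul_X_pow]
    rw [Finset.sum_eq_single_of_mem d₂ hd₂]
    · rw [hm, Nat.mul_div_cancel_left _ ha, if_pos rfl]
    · intro d hd hne
      refine if_neg fun hdm => hne ?_
      obtain ⟨s, t, hs, ht, hst⟩ := hexp d hd
      rw [hs, Nat.mul_div_cancel_left _ ha] at hdm
      ext k
      obtain rfl | rfl : k = 0 ∨ k = 1 := by omega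
      · rw [hs, hm, hdm]
      · rw [ht, hd₂1, show t = 0 by omega, mul_zero]
  obtain ⟨q, hq⟩ := IsAlgClosed.exists_root P fun hdeg => by
    have : P.coeff m = 0 := Polynomial.coeff_eq_zero_of_degree_lt (by
      rw [hdeg]; exact_mod_cast Nat.pos_of_ne_zero hm0)
    exact mem_support_iff.1 hd₂ (hPm.symm.trans this)
  refine ⟨q, a, b, ha, hb, ?_, ?_⟩
  · rw [hu, hv]
    norm_cast
    calc a * u = a * (b * u.gcd v) := by rw [← hub]
      _ = b * (a * u.gcd v) := by ring
      _ = b * v := by rw [← hva]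
  have hroot : ∑ d ∈ f.support, coeff d f * q ^ (d 0 / a) = 0 := by
    simpa [P, Polynomial.IsRoot.def, Polynomial.eval_finsetSum] using hq
  have hsum : ∑ d ∈ f.support, C (coeff d f * q ^ (d 0 / a)) * (X 1 ^ b) ^ m =
      (0 : MvPolynomial (Fin 2) K) := by
    rw [← Finset.sum_mul, ← map_sum, hroot, C_0, zero_mul]
  rw [← sub_zero f, ← hsum]
  nth_rw 1 [f.as_sum]
  rw [← Finset.sum_sub_distrib]
  refine Finset.dvd_sum fun d hd => ?_
  obtain ⟨s, t, hs, ht, rfl⟩ := hexp d hd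
  rw [monomial_eq_mul_pow_mul_pow (by decide : (0 : Fin 2) ≠ 1), hs, ht,
    Nat.mul_div_cancel_left _ ha]
  have : (C (coeff d f) : MvPolynomial (Fin 2) K) * X 0 ^ (a * s) * X 1 ^ (b * t)
      - C (coeff d f * q ^ s) * (X 1 ^ b) ^ (s + t) =
      ((X 0 ^ a) ^ s - (C q * X 1 ^ b) ^ s) * (C (coeff d f) * (X 1 ^ b) ^ t) := by
    rw [map_mul, map_pow]
    ring
  rw [this]
  exact (sub_dvd_pow_sub_pow _ _ s).mul_right _

end MvPolynomial

namespace Derivation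

variable {D : Derivation ℂ (MvPolynomial (Fin 2) ℂ) (MvPolynomial (Fin 2) ℂ)}
  {w : Fin 2 → ℤ} {e₀ : ℤ} {i j : Fin 2}

/-- A derivation is weighted homogeneous of degree `e₀` if it shifts weighted degrees by `e₀`. -/
def IsWeightedHomogeneous (D : Derivation ℂ (MvPolynomial (Fin 2) ℂ) (MvPolynomial (Fin 2) ℂ))
    (w : Fin 2 → ℤ) (e₀ : ℤ) : Prop :=
  ∀ (n : ℤ) (p : MvPolynomial (Fin 2) ℂ),
    p.IsWeightedHomogeneous w n → (D p).IsWeightedHomogeneous w (n + e₀)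

theorem IsWeightedHomogeneous.iterate (hhom : D.IsWeightedHomogeneous w e₀) {n : ℤ}
    {p : MvPolynomial (Fin 2) ℂ} (hp : p.IsWeightedHomogeneous w n) (k : ℕ) :
    ((⇑D)^[k] p).IsWeightedHomogeneous w (n + k * e₀) := by
  induction k with
  | zero => simpa using hp
  | succ k ih =>
    rw [Function.iterate_succ_apply']
    convert hhom _ _ ih using 1
    push_cast
    ring

theorem IsLocallyNilpotent.exists_apply_X_eq (hD : D.IsLocallyNilpotent) (hne : D ≠ 0)
    (hhom : D.IsWeightedHomogeneous w e₀) (hw : ∀ k, 0 < w k) (hij : i ≠ j)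
    (hDi : D (X i) = 0) : ∃ (c : ℂ) (e : ℕ), c ≠ 0 ∧ D (X j) = C c * X i ^ e := by
  have hchain := apply_eq_mul_pderiv hij D hDi
  have hDj : D (X j) ≠ 0 := fun h => hne (by ext1 k; rw [hchain, h]; simp)
  have hpd : pderiv j (D (X j)) = 0 := by
    have h := hD.apply_eq_zero_of_dvd_apply (Dvd.intro _ (hchain (D (X j))).symm)
    rw [hchain] at h
    exact (mul_eq_zero.1 h).resolve_left hDj
  have hsupp : ∀ d, coeff d (D (X j)) ≠ 0 → d j = 0 := by
    intro d hd
    by_contra hdj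
    have hle : Finsupp.single j 1 ≤ d := Finsupp.single_le_iff.2 (Nat.one_le_iff_ne_zero.2 hdj)
    have h := coeff_pderiv (D (X j)) (i := j) (d - Finsupp.single j 1)
    rw [hpd, coeff_zero, tsub_add_cancel_of_le hle, eq_comm, mul_eq_zero] at h
    exact h.elim hd (Nat.cast_add_one_ne_zero _)
  obtain ⟨c, e, hce, -⟩ :=
    (hhom _ _ (isWeightedHomogeneous_X ℂ w j)).exists_eq_C_mul_X_pow hij (hw i) hsupp
  exact ⟨c, e, fun hc => hDj (by rw [hce, hc, C_0, zero_mul]), hce⟩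

theorem IsLocallyNilpotent.exists_normal_form_of_apply_eq_zero (hD : D.IsLocallyNilpotent)
    (hne : D ≠ 0) (hhom : D.IsWeightedHomogeneous w e₀) (hw : ∀ k, 0 < w k) (hij : i ≠ j)
    {q : ℂ} {m : ℕ} (hq : q ≠ 0 → m * w i = w j) (hker : D (X j - C q * X i ^ m) = 0) :
    ∃ i j : Fin 2, i ≠ j ∧ ∃ (φ : MvPolynomial (Fin 2) ℂ ≃ₐ[ℂ] MvPolynomial (Fin 2) ℂ) (e : ℕ),
      (∀ (n : ℤ) (p : MvPolynomial (Fin 2) ℂ),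
        p.IsWeightedHomogeneous w n → (φ p).IsWeightedHomogeneous w n) ∧
      φ.symm (D (φ (X i))) = 0 ∧ φ.symm (D (φ (X j))) = X i ^ e := by
  let φ := triangularEquiv hij (one_ne_zero (α := ℂ)) (-q) m
  have hφ : ∀ {n p}, p.IsWeightedHomogeneous w n → (φ p).IsWeightedHomogeneous w n :=
    fun hp => hp.triangularEquiv hij _ (by simpa using hq)
  have hφ' : ∀ {n p}, p.IsWeightedHomogeneous w n → (φ.symm p).IsWeightedHomogeneous w n :=
    fun hp => hp.triangularEquiv_symm hij _ (by simpa using hq)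
  have hDj : D.conj φ (X j) = 0 := by
    have : φ (X j) = X j - C q * X i ^ m := by
      simp [φ, sub_eq_add_neg]
    rw [conj_apply, this, hker, map_zero]
  obtain ⟨c, e, hc, hce⟩ := (hD.conj φ).exists_apply_X_eq (conj_ne_zero hne φ)
    (fun n p hp => hφ' (hhom _ _ (hφ hp))) hw hij.symm hDj
  let ψ := triangularEquiv hij.symm (inv_ne_zero hc) 0 0
  have hψj : ψ (X j) = X j := by simp [ψ]
  have hψi : ψ (X i) = C c⁻¹ * X i := by simp [ψ]
  have hψj' : ψ.symm (X j) = X j := by simp [ψ]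
  refine ⟨j, i, hij.symm, ψ.trans φ, e, fun n p hp =>
    hφ (hp.triangularEquiv hij.symm (inv_ne_zero hc) (by simp)), ?_, ?_⟩
  · change ψ.symm (D.conj φ (ψ (X j))) = 0
    rw [hψj, hDj, map_zero]
  · change ψ.symm (D.conj φ (ψ (X i))) = X j ^ e
    rw [hψi, derivation_apply_C_mul, hce, ← mul_assoc, ← C_mul, inv_mul_cancel₀ hc, C_1,
      one_mul, map_pow, hψj']

theorem IsWeightedHomogeneous.exists_apply_X_sub_eq_zero_of_neg (hhom : D.IsWeightedHomogeneous w e₀)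
    (hw : ∀ k, 0 < w k) (he₀ : e₀ < 0) :
    ∃ i j : Fin 2, i ≠ j ∧ ∃ (q : ℂ) (m : ℕ), (q ≠ 0 → m * w i = w j) ∧
      D (X j - C q * X i ^ m) = 0 := by
  obtain ⟨i, j, hij, hle⟩ : ∃ i j : Fin 2, i ≠ j ∧ w i ≤ w j := by
    obtain h | h := le_total (w 0) (w 1)
    · exact ⟨0, 1, by decide, h⟩
    · exact ⟨1, 0, by decide, h⟩
  obtain ⟨c, k, hck, hk⟩ := (hhom _ _ (isWeightedHomogeneous_X ℂ w i)).exists_eq_C_mul_X_pow_of_lt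
    hij hw (by omega)
  obtain rfl | hc := eq_or_ne c 0
  · exact ⟨j, i, hij.symm, 0, 0, by simp, by simp [hck]⟩
  obtain ⟨c', m, hcm, hm⟩ := (hhom _ _ (isWeightedHomogeneous_X ℂ w j)).exists_eq_C_mul_X_pow_of_lt
    hij hw (by omega)
  have hk0 : k = 0 := by
    by_contra h
    have h1 : (1 : ℤ) ≤ k := by exact_mod_cast Nat.one_le_iff_ne_zero.2 h
    nlinarith [hk hc, hw i]
  subst hk0
  have hm1 : (m + 1 : ℂ) ≠ 0 := Nat.cast_add_one_ne_zero m
  refine ⟨i, j, hij, c' / (c * (m + 1)), m + 1, fun hq => ?_, ?_⟩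
  · have h1 := hm fun h => hq (by simp [h])
    have h2 := hk hc
    push_cast at h2 ⊢
    linarith
  · rw [map_sub, derivation_apply_C_mul, leibniz_pow, hck, hcm]
    simp only [pow_zero, mul_one, add_tsub_cancel_right, smul_eq_mul, nsmul_eq_mul]
    have h : C (c' / (c * (m + 1))) * (C c * ((m : MvPolynomial (Fin 2) ℂ) + 1)) = C c' := by
      have h' : ((m : MvPolynomial (Fin 2) ℂ) + 1) = C (m + 1 : ℂ) := by simp
      rw [h', ← C_mul, ← C_mul, div_mul_cancel₀ _ (mul_ne_zero hc hm1)]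
    push_cast
    linear_combination (-X i ^ m) * h

theorem IsLocallyNilpotent.exists_apply_X_eq_zero_of_binomial (hD : D.IsLocallyNilpotent)
    {q : ℂ} (hq : q ≠ 0) {a b : ℕ}
    (hker : D (X 0 ^ (a + 2) - C q * X 1 ^ (b + 2)) = 0) : ∃ i, D (X i) = 0 := by
  have h : (a + 2 : ℂ) • (X 0 ^ (a + 1) * D (X 0)) =
      (q * (b + 2)) • (X 1 ^ (b + 1) * D (X 1)) := by
    rw [map_sub, derivation_apply_C_mul, leibniz_pow, leibniz_pow, sub_eq_zero] at hker
    simp only [smul_eq_mul, nsmul_eq_mul, smul_eq_C_mul] at hker ⊢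
    have h2 : (C 2 : MvPolynomial (Fin 2) ℂ) = 2 := map_ofNat C 2
    simpa [mul_assoc, h2] using hker
  have ha : (a + 2 : ℂ) ≠ 0 := by exact_mod_cast (by omega : a + 2 ≠ 0)
  have hb : (b + 2 : ℂ) ≠ 0 := by exact_mod_cast (by omega : b + 2 ≠ 0)
  have hdvd : ∀ {i j : Fin 2} {k l : ℕ} {r s : ℂ}, i ≠ j → s ≠ 0 →
      r • (X i ^ (k + 1) * D (X i)) = s • (X j ^ (l + 1) * D (X j)) → X i ∣ D (X j) := by
    intro i j k l r s hij hs h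
    have h1 : X i ∣ X j ^ (l + 1) * D (X j) := by
      rw [← inv_smul_smul₀ hs (X j ^ (l + 1) * D (X j)), ← h, pow_succ', mul_assoc]
      exact dvd_smul_of_dvd _ (dvd_smul_of_dvd _ (dvd_mul_right _ _))
    refine (X_prime.dvd_or_dvd h1).resolve_left fun h2 => hij ?_
    exact X_dvd_X.1 (X_prime.dvd_of_dvd_pow h2)
  exact (hD.apply_eq_zero_or_of_dvd_of_dvd (hdvd (by decide) (mul_ne_zero hq hb) h)
    (hdvd (by decide) ha h.symm)).elim (⟨_, ·⟩) (⟨_, ·⟩)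

theorem IsLocallyNilpotent.exists_apply_X_sub_eq_zero_of_nonneg (hD : D.IsLocallyNilpotent)
    (hhom : D.IsWeightedHomogeneous w e₀) (hw : ∀ k, 0 < w k) (he₀ : 0 ≤ e₀) :
    ∃ i j : Fin 2, i ≠ j ∧ ∃ (q : ℂ) (m : ℕ), (q ≠ 0 → m * w i = w j) ∧
      D (X j - C q * X i ^ m) = 0 := by
  suffices h : (∃ i, D (X i) = 0) ∨ ∃ i j : Fin 2, i ≠ j ∧ ∃ (q : ℂ) (m : ℕ),
      (q ≠ 0 → m * w i = w j) ∧ D (X j - C q * X i ^ m) = 0 by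
    obtain ⟨j, hj⟩ | h := h
    · obtain ⟨i, hij⟩ := exists_ne j
      exact ⟨i, j, hij, 0, 0, by simp, by simpa using hj⟩
    · exact h
  obtain ⟨k, hk⟩ := hD.exists_hasNilpotencyDegree (X_ne_zero (R := ℂ) (0 : Fin 2))
  have hDf : D ((⇑D)^[k] (X 0)) = 0 := by
    rw [← Function.iterate_succ_apply' D, hk.2]
  obtain ⟨i, hi⟩ | ⟨q, a, b, ha, hb, hab, hdvd⟩ :=
    (hhom.iterate (isWeightedHomogeneous_X ℂ w 0) k).exists_X_dvd_or_binomial_dvd hw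
      (add_pos_of_pos_of_nonneg (hw 0) (by positivity))
  · exact Or.inl ⟨i, hD.apply_eq_zero_of_dvd_s5 hk.1 hDf hi⟩
  have hker := hD.apply_eq_zero_of_dvd_s5 hk.1 hDf hdvd
  obtain rfl | hq := eq_or_ne q 0
  · refine Or.inl ⟨0, hD.apply_eq_zero_of_dvd_s5 (pow_ne_zero a (X_ne_zero _)) ?_
      (dvd_pow_self _ ha.ne')⟩
    simpa using hker
  match a, b, ha, hb with
  | 1, b, _, _ => exact Or.inr ⟨1, 0, by decide, q, b, fun _ => by simpa using hab.symm,
      by simpa using hker⟩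
  | a, 1, _, _ =>
    refine Or.inr ⟨0, 1, by decide, q⁻¹, a, fun _ => by simpa using hab, ?_⟩
    have : (X 1 - C q⁻¹ * X 0 ^ a : MvPolynomial (Fin 2) ℂ) =
        -(C q⁻¹ * (X 0 ^ a - C q * X 1 ^ 1)) := by
      have : (C q⁻¹ * C q : MvPolynomial (Fin 2) ℂ) = 1 := by
        rw [← C_mul, inv_mul_cancel₀ hq, C_1]
      linear_combination (-X 1) * this
    rw [this, map_neg, derivation_apply_C_mul, hker, mul_zero, neg_zero]
  | a + 2, b + 2, _, _ => exact Or.inl (hD.exists_apply_X_eq_zero_of_binomial hq hker)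

end Derivation

/-- Equip `ℂ[X,Y]` with the weighted grading with `deg X = d_X > 0`,
`deg Y = d_Y > 0`.  If `D` is a nonzero locally nilpotent `ℂ`-derivation of `ℂ[X,Y]` which is
homogeneous of some degree `e₀` for this grading, then there are a graded algebra automorphism
`φ` of `ℂ[X,Y]` and `e ≥ 0` such that the conjugate derivation `φ⁻¹ ∘ D ∘ φ` kills `X` and
sends `Y` to `X ^ e` — possibly after interchanging the roles of `X` and `Y`. -/
theorem homogeneous_lnd_on_weighted_plane_normal_form
    (dX dY : ℤ) (hdX : 0 < dX) (hdY : 0 < dY)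
    (D : Derivation ℂ (MvPolynomial (Fin 2) ℂ) (MvPolynomial (Fin 2) ℂ))
    (hD : D.IsLocallyNilpotent) (hne : D ≠ 0) (e₀ : ℤ)
    (hhom : ∀ (n : ℤ) (p : MvPolynomial (Fin 2) ℂ),
      p.IsWeightedHomogeneous ![dX, dY] n → (D p).IsWeightedHomogeneous ![dX, dY] (n + e₀)) :
    ∃ (φ : MvPolynomial (Fin 2) ℂ ≃ₐ[ℂ] MvPolynomial (Fin 2) ℂ) (e : ℕ),
      (∀ (n : ℤ) (p : MvPolynomial (Fin 2) ℂ),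
        p.IsWeightedHomogeneous ![dX, dY] n → (φ p).IsWeightedHomogeneous ![dX, dY] n) ∧
      ((φ.symm (D (φ (X 0))) = 0 ∧ φ.symm (D (φ (X 1))) = X 0 ^ e) ∨
       (φ.symm (D (φ (X 1))) = 0 ∧ φ.symm (D (φ (X 0))) = X 1 ^ e)) := by
  have hw : ∀ k, 0 < ![dX, dY] k := by
    intro k
    fin_cases k
    · exact hdX
    · exact hdY
  have hhom' : D.IsWeightedHomogeneous ![dX, dY] e₀ := hhom
  obtain ⟨i, j, hij, q, m, hq, hker⟩ : ∃ i j : Fin 2, i ≠ j ∧ ∃ (q : ℂ) (m : ℕ),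
      (q ≠ 0 → m * ![dX, dY] i = ![dX, dY] j) ∧ D (X j - C q * X i ^ m) = 0 := by
    obtain he₀ | he₀ := lt_or_ge e₀ 0
    · exact hhom'.exists_apply_X_sub_eq_zero_of_neg hw he₀
    · exact hD.exists_apply_X_sub_eq_zero_of_nonneg hhom' hw he₀
  obtain ⟨i, j, hij, φ, e, hφ, h⟩ :=
    hD.exists_normal_form_of_apply_eq_zero hne hhom' hw hij hq hker
  refine ⟨φ, e, hφ, ?_⟩
  obtain ⟨rfl, rfl⟩ | ⟨rfl, rfl⟩ : i = 0 ∧ j = 1 ∨ i = 1 ∧ j = 0 := by omega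
  · exact Or.inl h
  · exact Or.inr h
end

section
/- Let A = ⊕_{i∈ℤ} A_i be a ℤ-graded finitely generated normal integral domain over ℂ of Krull dimension 2 with A_0 of Krull dimension 1, and let ∂ be a homogeneous locally nilpotent ℂ-derivation of A whose restriction to A_0 is nonzero. Then A_0 is isomorphic as a ℂ-algebra to the polynomial ring ℂ[t] in one variable. -/
open scoped TensorProduct in
/-- A derivation of a domain extends to its fraction field. -/
theorem Derivation.exists_extension_fractionRing {k A K : Type*} [CommRing k] [CommRing A]
    [Algebra k A] [Field K] [Algebra k K] [Algebra A K] [IsScalarTower k A K]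
    [IsFractionRing A K] (D : Derivation k A A) :
    ∃ D' : Derivation k K K, ∀ a, D' (algebraMap A K a) = algebraMap A K (D a) := by
  have : Algebra.FormallyEtale A K := .of_isLocalization (nonZeroDivisors A)
  let φ : Ω[A⁄k] →ₗ[A] K := Algebra.linearMap A K ∘ₗ D.liftKaehlerDifferential
  let ψ : Ω[K⁄k] →ₗ[K] K :=
    φ.liftBaseChange K ∘ₗ
      (KaehlerDifferential.tensorKaehlerEquivOfFormallyEtale k A K).symm.toLinearMap
  refine ⟨ψ.compDer (KaehlerDifferential.D k K), fun a ↦ ?_⟩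
  simp [ψ, φ, KaehlerDifferential.tensorKaehlerEquivOfFormallyEtale_symm_D_algebraMap]

/-- In characteristic zero, an element that is not killed by a derivation is transcendental over
every subalgebra killed by the derivation. -/
theorem Derivation.transcendental_of_ne_zero {k K : Type*} [CommRing k] [CommRing K] [IsDomain K]
    [CharZero K] [Algebra k K] (D : Derivation k K K) (S : Subalgebra k K)
    (hS : ∀ x ∈ S, D x = 0) {z : K} (hz : D z ≠ 0) : Transcendental S z := by
  let D' : Derivation S K K := Derivation.mk'
    { toFun := D
      map_add' := map_add D
      map_smul' := fun r x ↦ by simp [Algebra.smul_def, hS] }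
    fun a b ↦ D.leibniz a b
  have hD' : D' z ≠ 0 := hz
  have key : ∀ n : ℕ, ∀ p : Polynomial S, p.natDegree ≤ n → Polynomial.aeval z p = 0 → p = 0 := by
    intro n
    induction n with
    | zero =>
      intro p hp h
      rw [Polynomial.eq_C_of_natDegree_le_zero hp] at h ⊢
      simpa [Subalgebra.algebraMap_def] using h
    | succ n ih =>
      intro p hp h
      have h1 : Polynomial.aeval z (Polynomial.derivative p) = 0 := by
        have := D'.map_aeval p z
        rw [h, map_zero] at this
        simpa [hD'] using this.symm
      have h2 := ih _ (by have := Polynomial.natDegree_derivative_le p; omega) h1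
      have h3 := Polynomial.derivative_eq_zero.1 h2
      rw [Polynomial.eq_C_of_natDegree_le_zero h3.le] at h ⊢
      simpa [Subalgebra.algebraMap_def] using h
  rw [transcendental_iff]
  exact fun p ↦ key _ p le_rfl

/-- An injective integral ring extension does not decrease the Krull dimension. -/
theorem ringKrullDim_le_of_isIntegral_of_injective {R S : Type*} [CommRing R] [CommRing S]
    [Algebra R S] [Algebra.IsIntegral R S] [FaithfulSMul R S] :
    ringKrullDim R ≤ ringKrullDim S := by
  refine iSup_le fun l ↦ ?_
  obtain ⟨Q, hQ, hQl⟩ := Ideal.nonempty_primesOver (S := S) l.head.asIdeal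
  obtain ⟨L, hL, -⟩ := Ideal.exists_ltSeries_of_hasGoingUp l Q
  rw [← hL]
  exact Order.LTSeries.length_le_krullDim L

theorem Algebra.trdeg_le_of_ringKrullDim_eq {k A : Type*} [Field k] [CommRing A] [IsDomain A]
    [Algebra k A] [Algebra.FiniteType k A] {n : ℕ} (h : ringKrullDim A = n) :
    Algebra.trdeg k A ≤ n := by
  obtain ⟨s, g, hg, hint⟩ := exists_integral_inj_algHom_of_fg k A
  algebraize [g.toRingHom]
  have : FaithfulSMul (MvPolynomial (Fin s) k) A := (faithfulSMul_iff_algebraMap_injective _ _).2 hg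
  have hle := ringKrullDim_le_of_isIntegral_of_injective (R := MvPolynomial (Fin s) k) (S := A)
  rw [MvPolynomial.ringKrullDim_of_isNoetherianRing, h, ringKrullDim_eq_zero_of_field, zero_add,
    Nat.card_fin] at hle
  have hsn : s ≤ n := by exact_mod_cast hle
  have : IsScalarTower k (MvPolynomial (Fin s) k) A := .of_algebraMap_eq fun r ↦ (g.commutes r).symm
  have hcard := ((IsTranscendenceBasis.mvPolynomial (Fin s) k).algebraMap_comp
    (A := A)).lift_cardinalMk_eq_trdeg
  simp only [Cardinal.mk_fin, Cardinal.lift_natCast, Cardinal.lift_id'] at hcard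
  rw [← Cardinal.lift_uzero (Algebra.trdeg k A), ← hcard, Cardinal.lift_natCast]
  exact_mod_cast hsn

/-- If `x` is transcendental and killed by two derivations `D` and `E`, and `y` and `z` are such that
`D y` and `E z` are nonzero while `E y = 0`, then the transcendence degree is at least three. -/
theorem three_le_trdeg_of_derivations {k K : Type*} [Field k] [Field K] [CharZero K] [Algebra k K]
    (D E : Derivation k K K) {x y z : K} (hx : Transcendental k x) (hDx : D x = 0) (hEx : E x = 0)
    (hDy : D y ≠ 0) (hEy : E y = 0) (hEz : E z ≠ 0) : 3 ≤ Algebra.trdeg k K := by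
  have h1 : AlgebraicIndependent k (fun _ : Unit ↦ x) := algebraicIndependent_unique_type_iff.2 hx
  have kill : ∀ (δ : Derivation k K K) (s : Set K), (∀ a ∈ s, δ a = 0) →
      ∀ a ∈ Algebra.adjoin k s, δ a = 0 := fun δ s hs a ha ↦
    Derivation.eqOn_adjoin (D1 := δ) (D2 := 0) (fun b hb ↦ by simpa using hs b hb) ha
  have h2 := (h1.option_iff_transcendental y).2
    (D.transcendental_of_ne_zero _ (kill D _ (by simpa using hDx)) hDy)
  have h3 := (h2.option_iff_transcendental z).2
    (E.transcendental_of_ne_zero _ (kill E _ (by simp [Option.forall]; grind)) hEz)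
  have := h3.lift_cardinalMk_le_trdeg
  rw [Cardinal.mk_fintype, Cardinal.lift_natCast, Cardinal.lift_uzero] at this
  refine le_trans (le_of_eq ?_) this
  norm_num

open DirectSum in
/-- The Euler derivation of a `ℤ`-graded algebra, multiplying each homogeneous element by its
degree. -/
theorem GradedAlgebra.exists_euler_derivation {k A : Type*} [CommRing k] [CommRing A] [Algebra k A]
    (𝒜 : ℤ → Submodule k A) [GradedAlgebra 𝒜] :
    ∃ E : Derivation k A A, ∀ i, ∀ a ∈ 𝒜 i, E a = (i : A) * a := by
  let L : A →ₗ[k] A := DirectSum.toModule k ℤ A (fun i ↦ (i : k) • (𝒜 i).subtype) ∘ₗ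
    (decomposeLinearEquiv 𝒜).toLinearMap
  have hL : ∀ i, ∀ a ∈ 𝒜 i, L a = (i : A) * a := by
    intro i a ha
    have : decompose 𝒜 a = lof k ℤ (fun i ↦ 𝒜 i) i ⟨a, ha⟩ := decompose_of_mem 𝒜 ha
    simp [L, decomposeLinearEquiv_apply, this, Algebra.smul_def]
  refine ⟨Derivation.mk' L fun a b ↦ ?_, hL⟩
  induction a using DirectSum.Decomposition.inductionOn 𝒜 with
  | zero => simp
  | add a a' ha ha' => simp only [add_mul, map_add, ha, ha', smul_eq_mul, mul_add]; ring
  | homogeneous a =>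
    induction b using DirectSum.Decomposition.inductionOn 𝒜 with
    | zero => simp
    | add b b' hb hb' => simp only [mul_add, map_add, hb, hb', smul_eq_mul, add_mul]; ring
    | homogeneous b =>
      rw [hL _ _ (SetLike.mul_mem_graded a.2 b.2), hL _ _ a.2, hL _ _ b.2]
      push_cast
      simp only [smul_eq_mul]
      ring

theorem GradedAlgebra.exists_mem_ne_zero_of_grade_zero_ne_top {k A : Type*} [CommRing k]
    [CommRing A] [Algebra k A] (𝒜 : ℤ → Submodule k A) [GradedAlgebra 𝒜] (h : 𝒜 0 ≠ ⊤) :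
    ∃ j ≠ 0, ∃ z ∈ 𝒜 j, z ≠ 0 := by
  by_contra! hz
  refine h (eq_top_iff.2 fun a _ ↦ ?_)
  induction a using DirectSum.Decomposition.inductionOn 𝒜 with
  | zero => exact zero_mem _
  | add a b ha hb => exact add_mem (ha trivial) (hb trivial)
  | @homogeneous i a =>
    by_cases hi : i = 0
    · exact hi ▸ a.2
    · rw [hz i hi a a.2]
      exact zero_mem _

/-- Homogeneous elements of the same degree in the kernel of a derivation are proportional, if the
transcendence degree is two and the derivation is nonzero in degree zero. -/
theorem GradedAlgebra.exists_eq_smul_of_derivation_eq_zero {k A : Type*} [Field k] [IsAlgClosed k]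
    [CharZero k] [CommRing A] [IsDomain A] [Algebra k A]
    (𝒜 : ℤ → Submodule k A) [GradedAlgebra 𝒜] (htr : Algebra.trdeg k A ≤ 2) (h0 : 𝒜 0 ≠ ⊤)
    (D : Derivation k A A) {f : A} (hf : f ∈ 𝒜 0) (hDf : D f ≠ 0) {i : ℤ} {b b' : A}
    (hb : b ∈ 𝒜 i) (hb' : b' ∈ 𝒜 i) (hDb : D b = 0) (hDb' : D b' = 0) (hne : b' ≠ 0) :
    ∃ c : k, b = c • b' := by
  let K := FractionRing A
  have : CharZero K := charZero_of_injective_algebraMap (algebraMap k K).injective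
  have hinj : Function.Injective (algebraMap A K) := FaithfulSMul.algebraMap_injective A K
  obtain ⟨D', hD'⟩ := D.exists_extension_fractionRing (K := K)
  obtain ⟨E, hE⟩ := exists_euler_derivation 𝒜
  obtain ⟨E', hE'⟩ := E.exists_extension_fractionRing (K := K)
  obtain ⟨j, hj, z, hz, hz0⟩ := exists_mem_ne_zero_of_grade_zero_ne_top 𝒜 h0
  have hneK : algebraMap A K b' ≠ 0 := by simpa using hne
  have htrK : Algebra.trdeg k K ≤ 2 := by
    have := FaithfulSMul.trans k A K
    have : Algebra.IsAlgebraic A K := IsLocalization.isAlgebraic K (nonZeroDivisors A)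
    rw [← trdeg_add_eq k A (A := K), trdeg_eq_zero (R := A), add_zero]
    exact htr
  by_cases hx : Transcendental k (algebraMap A K b / algebraMap A K b')
  · have := three_le_trdeg_of_derivations D' E' hx (y := algebraMap A K f) (z := algebraMap A K z)
      (by simp [Derivation.leibniz_div, hD', hDb, hDb'])
      (by
        rw [Derivation.leibniz_div, hE', hE', hE _ _ hb, hE _ _ hb']
        simp only [map_mul, smul_eq_mul]
        ring)
      (by simpa [hD'] using hDf) (by simp [hE', hE _ _ hf])
      (by simpa [hE', hE _ _ hz, hz0] using hj)
    have := this.trans htrK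
    norm_num at this
  · rw [Transcendental, not_not] at hx
    obtain ⟨c, hc⟩ := minpoly.mem_range_of_degree_eq_one k _
      (IsAlgClosed.degree_eq_one_of_irreducible k (minpoly.irreducible hx.isIntegral))
    refine ⟨c, hinj ?_⟩
    rw [Algebra.smul_def, map_mul, ← IsScalarTower.algebraMap_apply, hc, div_mul_cancel₀ _ hneK]

theorem Derivation.iterate_mul_of_eq_zero {k A : Type*} [CommRing k] [CommRing A] [Algebra k A]
    (D : Derivation k A A) {b : A} (hb : D b = 0) (m : ℕ) (f : A) :
    D^[m] (b * f) = b * D^[m] f := by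
  induction m generalizing f with
  | zero => rfl
  | succ m ih => simp [ih, hb]

theorem Derivation.iterate_pow_of_apply_apply_eq_zero {k A : Type*} [CommRing k] [CommRing A]
    [Algebra k A] (D : Derivation k A A) {s : A} (hs : D (D s) = 0) (m : ℕ) :
    D^[m] (s ^ m) = m.factorial * D s ^ m := by
  induction m with
  | zero => simp
  | succ m ih =>
    have : D (s ^ (m + 1)) = ((m + 1 : ℕ) * D s) * s ^ m := by
      rw [D.leibniz_pow]
      simp only [Nat.add_sub_cancel, smul_eq_mul, nsmul_eq_mul]
      ring
    rw [Function.iterate_succ_apply, this, D.iterate_mul_of_eq_zero (by simp [hs]), ih,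
      Nat.factorial_succ]
    push_cast
    ring

theorem Derivation.iterate_mem_of_homogeneous {k A : Type*} [CommRing k] [CommRing A] [Algebra k A]
    {𝒜 : ℤ → Submodule k A} {D : Derivation k A A} {e : ℤ}
    (hhom : ∀ n, ∀ a ∈ 𝒜 n, D a ∈ 𝒜 (n + e)) {n : ℤ} {a : A} (ha : a ∈ 𝒜 n) (m : ℕ) :
    D^[m] a ∈ 𝒜 (n + m * e) := by
  induction m with
  | zero => simpa using ha
  | succ m ih =>
    rw [Function.iterate_succ_apply']
    convert hhom _ _ ih using 2
    push_cast
    ring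

theorem Nat.exists_dvd_of_sub_mem {S : Set ℕ} (hsub : ∀ a ∈ S, ∀ b ∈ S, b ≤ a → a - b ∈ S)
    (hpos : ∃ a ∈ S, 0 < a) : ∃ m ∈ S, 0 < m ∧ ∀ a ∈ S, m ∣ a := by
  classical
  have hm := Nat.find_spec hpos
  refine ⟨Nat.find hpos, hm.1, hm.2, fun a ↦ ?_⟩
  induction a using Nat.strong_induction_on with
  | _ a ih =>
    intro ha
    rcases Nat.eq_zero_or_pos a with rfl | hapos
    · exact dvd_zero _
    · have hle := Nat.find_min' hpos ⟨ha, hapos⟩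
      have := ih (a - Nat.find hpos) (by omega) (hsub _ ha _ hm.1 hle)
      exact (Nat.dvd_sub_iff_left hle dvd_rfl).1 this

/-- Suppose kernel elements of equal degree of a homogeneous locally nilpotent derivation `D` are
proportional, and `s` is a homogeneous local slice with `n * deg s = (n - 1) * deg (D s)`.
Then the degree zero part of the localization at `D s` is generated by one fraction. -/
theorem GradedAlgebra.exists_fraction_generator {k A K : Type*} [Field k] [CharZero k] [CommRing A]
    [IsDomain A] [Algebra k A] [Field K] [Algebra k K] [Algebra A K] [IsScalarTower k A K]
    [IsFractionRing A K] (𝒜 : ℤ → Submodule k A) [GradedAlgebra 𝒜] (D : Derivation k A A)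
    (hD : ∀ f, ∃ m : ℕ, D^[m] f = 0) {e : ℤ} (hhom : ∀ n, ∀ a ∈ 𝒜 n, D a ∈ 𝒜 (n + e))
    (hprop : ∀ i, ∀ b ∈ 𝒜 i, ∀ b' ∈ 𝒜 i, D b = 0 → D b' = 0 → b' ≠ 0 → ∃ c : k, b = c • b')
    {σ d : ℤ} {n : ℕ} (hn : 0 < n) (hσ : n * σ = (n - 1) * d) (he : σ + e = d) {s : A}
    (hs : s ∈ 𝒜 σ) (hDs : D s ∈ 𝒜 d) (hDDs : D (D s) = 0) (hne : D s ≠ 0) :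
    ∃ (N : ℕ) (a : A), a ∈ 𝒜 (N * d) ∧ ∀ (M : ℕ) (f : A), f ∈ 𝒜 (M * d) → ∃ P : Polynomial k,
      algebraMap A K f = algebraMap A K (D s) ^ M *
        Polynomial.aeval (algebraMap A K a / algebraMap A K (D s) ^ N) P := by
  have : CharZero A := charZero_of_injective_algebraMap (algebraMap k A).injective
  have hneK : algebraMap A K (D s) ≠ 0 := by simpa using hne
  set h := D s with hh
  let S : Set ℕ := {m | ∃ N : ℕ, ∃ b ∈ 𝒜 (N * d - m * σ), b ≠ 0 ∧ D b = 0}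
  have hsub : ∀ a ∈ S, ∀ b ∈ S, b ≤ a → a - b ∈ S := by
    rintro p ⟨N, b, hb, hb0, hDb⟩ q ⟨M, b', hb', hb0', hDb'⟩ hpq
    refine ⟨N + (n - 1) * M, b * (b' ^ (n - 1) * h ^ (q * (n - 1))), ?_, by positivity, ?_⟩
    · convert SetLike.mul_mem_graded hb (SetLike.mul_mem_graded
        (SetLike.pow_mem_graded (n - 1) hb') (SetLike.pow_mem_graded (q * (n - 1)) hDs)) using 2
      simp only [nsmul_eq_mul]
      push_cast [hpq, Nat.cast_sub hn]
      linear_combination (q : ℤ) * hσ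
    · simp [D.leibniz_pow, hDb, hDb', hDDs]
  have hpos : ∃ a ∈ S, 0 < a := by
    refine ⟨n, ⟨n, h, ?_, hne, hDDs⟩, hn⟩
    convert hDs using 2
    linear_combination -hσ
  obtain ⟨m, ⟨N, b, hb, hb0, hDb⟩, -, hdvd⟩ := Nat.exists_dvd_of_sub_mem hsub hpos
  have ha : b * s ^ m ∈ 𝒜 (N * d) := by
    convert SetLike.mul_mem_graded hb (SetLike.pow_mem_graded m hs) using 2
    simp
  refine ⟨N, b * s ^ m, ha, ?_⟩
  have key : ∀ (l M : ℕ) (f : A), f ∈ 𝒜 (M * d) → D^[l] f = 0 → ∃ P : Polynomial k,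
      algebraMap A K f = algebraMap A K h ^ M *
        Polynomial.aeval (algebraMap A K (b * s ^ m) / algebraMap A K h ^ N) P := by
    intro l
    induction l with
    | zero => exact fun M f _ hf ↦ ⟨0, by simpa using hf⟩
    | succ l ih =>
      intro M f hfM hf
      by_cases hl : D^[l] f = 0
      · exact ih M f hfM hl
      have hlS : l ∈ S := by
        refine ⟨M + l, D^[l] f, ?_, hl, by rwa [Function.iterate_succ_apply'] at hf⟩
        convert Derivation.iterate_mem_of_homogeneous hhom hfM l using 2
        push_cast
        linear_combination -(l : ℤ) * he
      obtain ⟨q, rfl⟩ := hdvd l hlS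
      have hDh : ∀ j, D (h ^ j) = 0 := fun j ↦ by simp [D.leibniz_pow, hDDs]
      have hDb' : ∀ j, D (b ^ j) = 0 := fun j ↦ by simp [D.leibniz_pow, hDb]
      have hu : h ^ (q * N) * f ∈ 𝒜 ((M + q * N : ℕ) * d) := by
        convert SetLike.mul_mem_graded (SetLike.pow_mem_graded (q * N) hDs) hfM using 2
        simp only [nsmul_eq_mul]
        push_cast
        ring
      have hv : h ^ M * (b * s ^ m) ^ q ∈ 𝒜 ((M + q * N : ℕ) * d) := by
        convert SetLike.mul_mem_graded (SetLike.pow_mem_graded M hDs)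
          (SetLike.pow_mem_graded q ha) using 2
        simp only [nsmul_eq_mul]
        push_cast
        ring
      have hDu : D^[m * q] (h ^ (q * N) * f) = h ^ (q * N) * D^[m * q] f :=
        D.iterate_mul_of_eq_zero (hDh _) _ _
      have hDv : D^[m * q] (h ^ M * (b * s ^ m) ^ q) =
          h ^ M * (b ^ q * ((m * q).factorial * h ^ (m * q))) := by
        rw [D.iterate_mul_of_eq_zero (hDh _), mul_pow, ← pow_mul,
          D.iterate_mul_of_eq_zero (hDb' _), D.iterate_pow_of_apply_apply_eq_zero hDDs]
      obtain ⟨c, hc⟩ := hprop _ _ (Derivation.iterate_mem_of_homogeneous hhom hu (m * q)) _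
        (Derivation.iterate_mem_of_homogeneous hhom hv (m * q))
        (by
          rw [hDu, D.leibniz, hDh, ← Function.iterate_succ_apply' D, hf]
          simp)
        (by rw [hDv]; simp [hDh, hDb'])
        (by
          rw [hDv]
          have : ((m * q).factorial : A) ≠ 0 := by exact_mod_cast Nat.factorial_ne_zero _
          positivity)
      obtain ⟨P, hP⟩ := ih (M + q * N) (h ^ (q * N) * f - c • (h ^ M * (b * s ^ m) ^ q))
        (sub_mem hu (Submodule.smul_mem _ _ hv)) (by
          rw [iterate_map_sub, hc, Algebra.smul_def, Algebra.smul_def,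
            D.iterate_mul_of_eq_zero (D.map_algebraMap c), sub_self])
      refine ⟨P + Polynomial.C c * Polynomial.X ^ q, ?_⟩
      rw [map_sub, Algebra.smul_def, map_mul, map_mul, map_mul, map_pow, map_pow, map_pow,
        ← IsScalarTower.algebraMap_apply, sub_eq_iff_eq_add] at hP
      generalize algebraMap A K (b * s ^ m) = w at hP ⊢
      have hne' := pow_ne_zero (q * N) hneK
      apply mul_left_cancel₀ hne'
      rw [hP, map_add, map_mul, Polynomial.aeval_C, map_pow, Polynomial.aeval_X, div_pow,
        ← pow_mul, mul_comm N q]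
      field_simp
      ring
  exact fun M f hf ↦ let ⟨l, hl⟩ := hD f; key l M f hf hl

theorem GradedAlgebra.mem_grade_zero_of_mul_mem {k A : Type*} [CommRing k] [CommRing A] [IsDomain A]
    [Algebra k A] (𝒜 : ℤ → Submodule k A) [GradedAlgebra 𝒜] {i : ℤ} {a b : A} (hb : b ∈ 𝒜 i)
    (hb0 : b ≠ 0) (hab : a * b ∈ 𝒜 i) : a ∈ 𝒜 0 := by
  have h := DirectSum.coe_decompose_mul_add_of_right_mem 𝒜 (i := 0) (a := a) hb
  rw [zero_add, DirectSum.decompose_of_mem_same 𝒜 hab] at h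
  rw [mul_right_cancel₀ hb0 h]
  exact SetLike.coe_mem _

/-- The degree zero part of a normal graded domain of transcendence degree at most two is a
polynomial ring, if it carries a homogeneous locally nilpotent derivation that is nonzero in degree
zero. -/
theorem GradedAlgebra.exists_polynomial_algHom_range_eq {k A : Type*} [Field k] [IsAlgClosed k]
    [CharZero k] [CommRing A] [IsDomain A] [Algebra k A] [IsIntegrallyClosed A]
    (𝒜 : ℤ → Submodule k A) [GradedAlgebra 𝒜] (htr : Algebra.trdeg k A ≤ 2) (h0 : 𝒜 0 ≠ ⊤)
    (D : Derivation k A A) (hD : ∀ f, ∃ m : ℕ, D^[m] f = 0) {e : ℤ}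
    (hhom : ∀ n, ∀ a ∈ 𝒜 n, D a ∈ 𝒜 (n + e)) (hhor : ∃ a ∈ 𝒜 0, D a ≠ 0) :
    ∃ f : Polynomial k →ₐ[k] A, Function.Injective f ∧ Set.range f = (𝒜 0 : Set A) := by
  classical
  let K := FractionRing A
  have : CharZero A := charZero_of_injective_algebraMap (algebraMap k A).injective
  have hinj : Function.Injective (algebraMap A K) := FaithfulSMul.algebraMap_injective A K
  obtain ⟨f, hf, hDf⟩ := hhor
  obtain ⟨n, hn, hn'⟩ : ∃ n, D^[n + 1] f ≠ 0 ∧ D^[n + 2] f = 0 := by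
    have hm := Nat.find_spec (hD f)
    have hlt : 1 < Nat.find (hD f) := by
      by_contra! hle
      interval_cases hfind : Nat.find (hD f)
      · exact hDf (by rw [show f = 0 from hm, map_zero])
      · exact hDf hm
    obtain ⟨n, hn⟩ := Nat.exists_eq_add_of_le' hlt
    refine ⟨n, Nat.find_min (hD f) (by omega), by rwa [hn] at hm⟩
  have hs := Derivation.iterate_mem_of_homogeneous hhom hf n
  have hDs := Derivation.iterate_mem_of_homogeneous hhom hf (n + 1)
  rw [Function.iterate_succ_apply'] at hn hDs
  rw [Function.iterate_succ_apply', Function.iterate_succ_apply'] at hn'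
  obtain ⟨N, a, ha, hgen⟩ := exists_fraction_generator (K := K) 𝒜 D hD hhom
    (fun i b hb b' hb' hDb hDb' hne ↦
      exists_eq_smul_of_derivation_eq_zero 𝒜 htr h0 D hf hDf hb hb' hDb hDb' hne)
    (n := n + 1) n.succ_pos (by push_cast; ring) (by push_cast; ring) hs hDs hn' hn
  set h := D (D^[n] f)
  set τ := algebraMap A K a / algebraMap A K h ^ N with hτ
  have hgen0 : ∀ x ∈ 𝒜 0, ∃ P : Polynomial k, algebraMap A K x = Polynomial.aeval τ P :=
    fun x hx ↦ by simpa using hgen 0 x (by simpa using hx)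
  obtain ⟨P, hP⟩ := hgen0 f hf
  have hPdeg : P.natDegree ≠ 0 := by
    intro hdeg
    rw [Polynomial.eq_C_of_natDegree_eq_zero hdeg, Polynomial.aeval_C,
      IsScalarTower.algebraMap_apply k A K] at hP
    exact hDf (by rw [hinj hP, D.map_algebraMap])
  have hint : IsIntegral A τ := by
    have hP0 : P ≠ 0 := fun h ↦ hPdeg (by simp [h])
    refine .of_aeval_monic (p := (P * Polynomial.C P.leadingCoeff⁻¹).map (algebraMap k A))
      ((Polynomial.monic_mul_leadingCoeff_inv hP0).map _) ?_ ?_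
    · rwa [Polynomial.natDegree_map, Polynomial.natDegree_mul_leadingCoeff_inv _ hP0]
    · rw [Polynomial.aeval_map_algebraMap, map_mul, ← hP, Polynomial.aeval_C,
        IsScalarTower.algebraMap_apply k A K, ← map_mul]
      exact isIntegral_algebraMap
  obtain ⟨t, ht⟩ := IsIntegrallyClosed.isIntegral_iff.1 hint
  have ht0 : t ∈ 𝒜 0 := by
    have hhN := SetLike.pow_mem_graded N hDs
    have hneK : algebraMap A K h ≠ 0 := by simpa using hn
    refine mem_grade_zero_of_mul_mem 𝒜 hhN (pow_ne_zero N hn) ?_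
    rw [show t * h ^ N = a from hinj (by
      rw [map_mul, map_pow, ht, hτ, div_mul_cancel₀ _ (pow_ne_zero N hneK)])]
    simpa using ha
  have hPt : ∀ Q : Polynomial k, algebraMap A K (Polynomial.aeval t Q) = Polynomial.aeval τ Q :=
    fun Q ↦ by rw [← ht, Polynomial.aeval_algebraMap_apply]
  have hDt : D t ≠ 0 := by
    intro hDt
    rw [← hPt] at hP
    exact hDf (by rw [hinj hP, D.map_aeval, hDt, smul_zero])
  refine ⟨Polynomial.aeval t, ?_, ?_⟩
  · have := D.transcendental_of_ne_zero ⊥ (by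
      rintro _ ⟨r, rfl⟩
      exact D.map_algebraMap r) hDt
    exact transcendental_iff_injective.1
      (this.restrictScalars (FaithfulSMul.algebraMap_injective k (⊥ : Subalgebra k A)))
  · ext x
    constructor
    · rintro ⟨Q, rfl⟩
      exact Algebra.adjoin_le (S := SetLike.GradeZero.subalgebra 𝒜)
        (Set.singleton_subset_iff.2 ht0) (Polynomial.aeval_mem_adjoin_singleton k t)
    · intro hx
      obtain ⟨Q, hQ⟩ := hgen0 x hx
      exact ⟨Q, hinj (by rw [hPt, hQ])⟩

/-- Let `A = ⊕_{i ∈ ℤ} A_i` be a `ℤ`-graded finitely generated normal domain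
over `ℂ` of Krull dimension `2` with `A_0` of Krull dimension `1`, and let `D` be a homogeneous
locally nilpotent `ℂ`-derivation of `A` whose restriction to `A_0` is nonzero.  Then `A_0` is
isomorphic as a `ℂ`-algebra to the polynomial ring `ℂ[t]`: there is an injective `ℂ`-algebra
homomorphism `ℂ[t] → A` with range exactly `A_0`. -/
theorem grade_zero_polynomial_ring_of_horizontal_derivation
    {A : Type*} [CommRing A] [IsDomain A] [Algebra ℂ A] [Algebra.FiniteType ℂ A]
    [IsIntegrallyClosed A]
    (𝒜 : ℤ → Submodule ℂ A) [GradedAlgebra 𝒜]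
    (hdim : ringKrullDim A = 2)
    (hdim0 : ringKrullDim (SetLike.GradeZero.subalgebra 𝒜) = 1)
    (D : Derivation ℂ A A) (hD : D.IsLocallyNilpotent)
    (e : ℤ) (hhom : ∀ (n : ℤ), ∀ a ∈ 𝒜 n, D a ∈ 𝒜 (n + e))
    (hhor : ∃ a ∈ 𝒜 0, D a ≠ 0) :
    ∃ f : Polynomial ℂ →ₐ[ℂ] A, Function.Injective f ∧ Set.range f = (𝒜 0 : Set A) := by
  refine GradedAlgebra.exists_polynomial_algHom_range_eq 𝒜
    (by exact_mod_cast Algebra.trdeg_le_of_ringKrullDim_eq (n := 2) (by exact_mod_cast hdim)) ?_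
    D hD hhom hhor
  intro htop
  have heq : SetLike.GradeZero.subalgebra 𝒜 = ⊤ :=
    eq_top_iff.2 fun a _ ↦ show a ∈ 𝒜 0 from htop ▸ Submodule.mem_top
  rw [heq, ringKrullDim_eq_of_ringEquiv
    (Subalgebra.topEquiv (R := ℂ) (A := A)).toRingEquiv, hdim] at hdim0
  exact absurd hdim0 (by decide)
end
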